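/- arXiv:2006.07131 — 2 statements merged into one kernel-verified Lean document; each statement's English description precedes it below -/
import Mathlib

section
/- Let C, C₁, C₂, … be Archimedean copulas with (normalized, right-continuous at 0) generators φ, φ₁, φ₂, …. Then (φ_n) converges pointwise to φ on (0,1] if, and only if, (C_n) converges weakly conditional to C, i.e. for λ-almost every x ∈ [0,1] the probability measures K_{C_n}(x,·) converge weakly to K_C(x,·). -/
open MeasureTheory Filter Set
open scoped ENNReal

noncomputable section

/-- Right-hand derivative (of a convex function on `[0,1]`) of `f` at `x`, realized as the
infimum of the forward difference quotients with right endpoint in `(x, 1]`. -/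
noncomputable def rightD (f : ℝ → ℝ) (x : ℝ) : ℝ :=
  sInf ((fun y => (f y - f x) / (y - x)) '' Set.Ioc x 1)

/-- `φ : [0,1] → [0,∞]` is a (normalized, right-continuous at `0`) generator of an
Archimedean copula: convex, strictly decreasing, `φ 1 = 0`, finite on `(0,1]`,
right-continuous at `0` and normalized by `φ (1/2) = 1`. -/
structure IsGenerator (φ : ℝ → ℝ≥0∞) : Prop where
  convex : ∀ x ∈ Set.Icc (0:ℝ) 1, ∀ y ∈ Set.Icc (0:ℝ) 1, ∀ t ∈ Set.Icc (0:ℝ) 1,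
    φ (t * x + (1 - t) * y) ≤ ENNReal.ofReal t * φ x + ENNReal.ofReal (1 - t) * φ y
  strict_anti : ∀ x ∈ Set.Icc (0:ℝ) 1, ∀ y ∈ Set.Icc (0:ℝ) 1, x < y → φ y < φ x
  map_one : φ 1 = 0
  finite : ∀ x ∈ Set.Ioc (0:ℝ) 1, φ x < ⊤
  rightCont_zero : Filter.Tendsto φ (nhdsWithin 0 (Set.Ioi 0)) (nhds (φ 0))
  normalized : φ (1/2) = 1

/-- Pseudo-inverse `φ⁻` of a generator: `φ⁻ s = φ⁻¹ s` for `s < φ 0` and `0` for `s ≥ φ 0`. -/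
noncomputable def pseudoInv (φ : ℝ → ℝ≥0∞) (s : ℝ≥0∞) : ℝ :=
  sSup {x | x ∈ Set.Icc (0:ℝ) 1 ∧ s ≤ φ x}

/-- The Archimedean copula generated by `φ`: `C(x,y) = φ⁻(φ x + φ y)`. -/
noncomputable def archCopula (φ : ℝ → ℝ≥0∞) (x y : ℝ) : ℝ :=
  pseudoInv φ (φ x + φ y)

/-- The right-hand derivative `D⁺φ` of a generator. -/
noncomputable def Dplus (φ : ℝ → ℝ≥0∞) (x : ℝ) : ℝ :=
  rightD (fun t => (φ t).toReal) x

/-- The set `Cont(D⁺φ)` of continuity points of `D⁺φ` in `(0,1)`. -/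
def ContD (φ : ℝ → ℝ≥0∞) : Set ℝ :=
  {x | x ∈ Set.Ioo (0:ℝ) 1 ∧ ContinuousAt (Dplus φ) x}

/-- The `t`-level function `f^t(x) = φ⁻(φ t − φ x)` of the Archimedean copula generated
by `φ`. -/
noncomputable def levelFn (φ : ℝ → ℝ≥0∞) (t x : ℝ) : ℝ :=
  pseudoInv φ (φ t - φ x)

/-- The Kendall distribution function `F^Kendall(x) = x − φ(x)/D⁺φ(x)` of the Archimedean
copula generated by `φ`. -/
noncomputable def kendall (φ : ℝ → ℝ≥0∞) (x : ℝ) : ℝ :=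
  x - (φ x).toReal / Dplus φ x

/-- The Markov kernel (as conditional distribution function `(x,y) ↦ K_C(x,[0,y])`) of the
Archimedean copula generated by `φ`. -/
noncomputable def archKernel (φ : ℝ → ℝ≥0∞) (x y : ℝ) : ℝ :=
  if x = 0 ∨ x = 1 then 1
  else if y < levelFn φ 0 x then 0
  else Dplus φ x / Dplus φ (archCopula φ x y)

/-- The metric `D₁` between two copulas, expressed via their conditional distribution
functions `K₁, K₂` (with `Kᵢ x y = K_{Cᵢ}(x,[0,y])`). -/
noncomputable def D1 (K1 K2 : ℝ → ℝ → ℝ) : ℝ :=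
  ∫ y in Set.Icc (0:ℝ) 1, ∫ x in Set.Icc (0:ℝ) 1, |K1 x y - K2 x y|

/-- Conditional distribution function of the independence copula `Π`. -/
def piKernel : ℝ → ℝ → ℝ := fun _ y => y

/-- Dependence measure `ζ₁(C) = 3 D₁(C, Π)`. -/
noncomputable def zeta1 (K : ℝ → ℝ → ℝ) : ℝ := 3 * D1 K piKernel

/-- Dependence measure `r(C) = 6 ∫∫ K_C(x,[0,y])² dλ(x) dλ(y) − 2`. -/
noncomputable def rdep (K : ℝ → ℝ → ℝ) : ℝ :=
  6 * (∫ y in Set.Icc (0:ℝ) 1, ∫ x in Set.Icc (0:ℝ) 1, (K x y) ^ 2) - 2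

/-- Weak conditional convergence of a sequence of copulas, in terms of their conditional
distribution functions: for λ-a.e. `x ∈ [0,1]` the measures `K_{C_n}(x,·)` converge weakly
to `K_C(x,·)`, i.e. the conditional distribution functions converge at every continuity
point of `y ↦ K_C(x,[0,y])` in `[0,1]`. -/
def WeakCondConv (Kseq : ℕ → ℝ → ℝ → ℝ) (K : ℝ → ℝ → ℝ) : Prop :=
  ∀ᵐ x ∂(volume.restrict (Set.Icc (0:ℝ) 1)),
    ∀ y ∈ Set.Icc (0:ℝ) 1, ContinuousWithinAt (fun t => K x t) (Set.Icc 0 1) y →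
      Filter.Tendsto (fun n => Kseq n x y) Filter.atTop (nhds (K x y))

/-- The real-valued version of a generator. -/
def realGen (φ : ℝ → ℝ≥0∞) (t : ℝ) : ℝ := (φ t).toReal

lemma pseudoInv_nonneg (φ : ℝ → ℝ≥0∞) (s : ℝ≥0∞) : 0 ≤ pseudoInv φ s :=
  Real.sSup_nonneg fun _ hx => hx.1.1

lemma pseudoInv_le_one (φ : ℝ → ℝ≥0∞) (s : ℝ≥0∞) : pseudoInv φ s ≤ 1 :=
  Real.sSup_le (fun _ hx => hx.1.2) zero_le_one

namespace IsGenerator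

variable {φ : ℝ → ℝ≥0∞}

lemma antitoneOn (h : IsGenerator φ) : AntitoneOn φ (Icc 0 1) := by
  intro x hx y hy hxy
  rcases hxy.eq_or_lt with rfl | hlt
  · exact le_rfl
  · exact (h.strict_anti x hx y hy hlt).le

lemma ofReal_realGen (h : IsGenerator φ) {x : ℝ} (hx : x ∈ Ioc (0:ℝ) 1) :
    ENNReal.ofReal (realGen φ x) = φ x :=
  ENNReal.ofReal_toReal (h.finite x hx).ne

lemma realGen_one (h : IsGenerator φ) : realGen φ 1 = 0 := by
  simp [realGen, h.map_one]

lemma realGen_half (h : IsGenerator φ) : realGen φ (1/2) = 1 := by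
  simp only [realGen, h.normalized, ENNReal.toReal_one]

lemma realGen_nonneg (x : ℝ) : 0 ≤ realGen φ x := ENNReal.toReal_nonneg

lemma strictAntiOn_realGen (h : IsGenerator φ) : StrictAntiOn (realGen φ) (Ioc 0 1) := by
  intro x hx y hy hxy
  exact (ENNReal.toReal_lt_toReal (h.finite y hy).ne (h.finite x hx).ne).2
    (h.strict_anti x (Ioc_subset_Icc_self hx) y (Ioc_subset_Icc_self hy) hxy)

lemma convexOn_realGen (h : IsGenerator φ) : ConvexOn ℝ (Ioc 0 1) (realGen φ) := by
  refine ⟨convex_Ioc 0 1, fun x hx y hy a b ha hb hab => ?_⟩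
  obtain rfl : b = 1 - a := by linarith
  have hm := (convex_Ioc (0:ℝ) 1) hx hy ha hb hab
  have := h.convex x (Ioc_subset_Icc_self hx) y (Ioc_subset_Icc_self hy) a ⟨ha, by linarith⟩
  rw [← h.ofReal_realGen hx, ← h.ofReal_realGen hy, ← ENNReal.ofReal_mul ha,
    ← ENNReal.ofReal_mul hb, ← ENNReal.ofReal_add
      (mul_nonneg ha (realGen_nonneg x)) (mul_nonneg hb (realGen_nonneg y))] at this
  rw [← h.ofReal_realGen (by simpa using hm)] at this
  simpa using (ENNReal.ofReal_le_ofReal_iff (add_nonneg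
      (mul_nonneg ha (realGen_nonneg x)) (mul_nonneg hb (realGen_nonneg y)))).1 this

lemma continuousOn (h : IsGenerator φ) : ContinuousOn φ (Icc 0 1) := by
  intro x hx
  rcases hx.1.eq_or_lt with rfl | hx0
  · have h0 : ContinuousWithinAt φ (insert 0 (Ioi 0)) 0 :=
      continuousWithinAt_insert_self.2 h.rightCont_zero
    refine h0.mono fun z hz => ?_
    rcases hz.1.eq_or_lt with rfl | hz0
    · exact mem_insert _ _
    · exact mem_insert_of_mem _ hz0
  rcases hx.2.eq_or_lt with rfl | hx1
  · have hlim : Tendsto (fun z : ℝ => ENNReal.ofReal (2 * (1 - z))) (nhdsWithin 1 (Icc 0 1))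
        (nhds 0) := by
      have : Continuous fun z : ℝ => ENNReal.ofReal (2 * (1 - z)) :=
        ENNReal.continuous_ofReal.comp (by fun_prop)
      have h2 := (this.tendsto 1).mono_left (nhdsWithin_le_nhds (s := Icc (0:ℝ) 1))
      simpa using h2
    rw [ContinuousWithinAt, h.map_one]
    refine tendsto_of_tendsto_of_tendsto_of_le_of_le' tendsto_const_nhds hlim
      (Eventually.of_forall fun _ => zero_le) ?_
    have hev : ∀ᶠ z : ℝ in nhdsWithin 1 (Icc 0 1), 1/2 < z :=
      nhdsWithin_le_nhds (lt_mem_nhds (by norm_num))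
    filter_upwards [hev, self_mem_nhdsWithin] with z hz hz1
    have hz1' : z ≤ 1 := hz1.2
    have := h.convex (1/2) ⟨by norm_num, by norm_num⟩ 1 ⟨by norm_num, by norm_num⟩
      (2 * (1 - z)) ⟨by linarith, by linarith⟩
    rw [h.map_one, h.normalized, mul_zero, add_zero, mul_one, mul_one] at this
    convert! this using 2
    ring
  · have hc : ContinuousOn (realGen φ) (Ioo 0 1) :=
      (h.convexOn_realGen.subset Ioo_subset_Ioc_self (convex_Ioo 0 1)).continuousOn isOpen_Ioo
    have hc' : ContinuousAt (realGen φ) x := hc.continuousAt (Ioo_mem_nhds hx0 hx1)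
    have : ContinuousAt (fun z => ENNReal.ofReal (realGen φ z)) x :=
      ENNReal.continuous_ofReal.continuousAt.comp hc'
    refine (this.congr ?_).continuousWithinAt
    filter_upwards [Ioo_mem_nhds hx0 hx1] with z hz
    exact h.ofReal_realGen (Ioo_subset_Ioc_self hz)

lemma one_lt_apply_zero (h : IsGenerator φ) : 1 < φ 0 := by
  rw [← h.normalized]
  exact h.strict_anti _ ⟨le_rfl, zero_le_one⟩ _ ⟨by norm_num, by norm_num⟩ (by norm_num)

/-- Left endpoint values can be approximated from the right, strictly. -/
lemma exists_gt_lt_apply (h : IsGenerator φ) {x : ℝ} (hx : x ∈ Ico (0:ℝ) 1) {s : ℝ≥0∞}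
    (hs : s < φ x) {u : ℝ} (hu : x < u) : ∃ z ∈ Ioo x 1, z < u ∧ s < φ z := by
  have h1 : Tendsto φ (nhdsWithin x (Ioo x 1)) (nhds (φ x)) :=
    (h.continuousOn x ⟨hx.1, hx.2.le⟩).mono fun z hz => ⟨hx.1.trans hz.1.le, hz.2.le⟩
  have h2 : ∀ᶠ z in nhdsWithin x (Ioo x 1), s < φ z := h1.eventually (lt_mem_nhds hs)
  have h3 : ∀ᶠ z in nhdsWithin x (Ioo x 1), z < u := nhdsWithin_le_nhds (gt_mem_nhds hu)
  have : (nhdsWithin x (Ioo x 1)).NeBot := left_nhdsWithin_Ioo_neBot hx.2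
  obtain ⟨z, hz1, hz2, hz3⟩ := (h2.and (h3.and self_mem_nhdsWithin)).exists
  exact ⟨z, hz3, hz2, hz1⟩

lemma le_apply_pseudoInv (h : IsGenerator φ) {s : ℝ≥0∞} (hs : s ≤ φ 0) :
    s ≤ φ (pseudoInv φ s) := by
  have hc : IsCompact (Icc (0:ℝ) 1 ∩ φ ⁻¹' Ici s) :=
    isCompact_Icc.of_isClosed_subset (h.continuousOn.preimage_isClosed_of_isClosed
      isClosed_Icc isClosed_Ici) inter_subset_left
  exact (hc.sSup_mem ⟨0, ⟨le_rfl, zero_le_one⟩, hs⟩).2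

lemma le_pseudoInv_iff (h : IsGenerator φ) {s : ℝ≥0∞} {z : ℝ} (hz : z ∈ Ioc (0:ℝ) 1) :
    z ≤ pseudoInv φ s ↔ s ≤ φ z := by
  constructor
  · intro hle
    have hs : s ≤ φ 0 := by
      by_contra hcon
      have hemp : {x | x ∈ Icc (0:ℝ) 1 ∧ s ≤ φ x} = ∅ := by
        ext x
        simp only [mem_ofPred_eq, mem_empty_iff_false, iff_false, not_and]
        intro hx hsx
        exact hcon (hsx.trans (h.antitoneOn ⟨le_rfl, zero_le_one⟩ hx hx.1))
      rw [pseudoInv, hemp, Real.sSup_empty] at hle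
      exact absurd hz.1 (not_lt.2 hle)
    exact (h.le_apply_pseudoInv hs).trans (h.antitoneOn (Ioc_subset_Icc_self hz)
      ⟨pseudoInv_nonneg _ _, pseudoInv_le_one _ _⟩ hle)
  · intro hle
    exact le_csSup ⟨1, fun x hx => hx.1.2⟩ ⟨Ioc_subset_Icc_self hz, hle⟩

lemma pseudoInv_lt_iff (h : IsGenerator φ) {s : ℝ≥0∞} {z : ℝ} (hz : z ∈ Ioc (0:ℝ) 1) :
    pseudoInv φ s < z ↔ φ z < s := by
  rw [← not_le, h.le_pseudoInv_iff hz, not_le]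

lemma apply_pseudoInv (h : IsGenerator φ) {s : ℝ≥0∞} (hs : s ≤ φ 0) :
    φ (pseudoInv φ s) = s := by
  refine le_antisymm ?_ (h.le_apply_pseudoInv hs)
  rcases (pseudoInv_le_one φ s).eq_or_lt with h1 | h1
  · rw [h1, h.map_one]
    exact zero_le
  · by_contra! hcon
    obtain ⟨z, hz, -, hz'⟩ := h.exists_gt_lt_apply ⟨pseudoInv_nonneg _ _, h1⟩ hcon h1
    exact hz.1.not_ge ((h.le_pseudoInv_iff ⟨(pseudoInv_nonneg _ _).trans_lt hz.1, hz.2.le⟩).2 hz'.le)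

lemma pseudoInv_apply (h : IsGenerator φ) {x : ℝ} (hx : x ∈ Ioc (0:ℝ) 1) :
    pseudoInv φ (φ x) = x := by
  refine le_antisymm ?_ ((h.le_pseudoInv_iff hx).2 le_rfl)
  by_contra! hcon
  have hm : pseudoInv φ (φ x) ∈ Ioc (0:ℝ) 1 := ⟨hx.1.trans hcon, pseudoInv_le_one _ _⟩
  have := (h.le_pseudoInv_iff hm).1 le_rfl
  exact this.not_gt (h.strict_anti _ (Ioc_subset_Icc_self hx) _ (Ioc_subset_Icc_self hm) hcon)

lemma lt_pseudoInv (h : IsGenerator φ) {s : ℝ≥0∞} {z : ℝ} (hz : z ∈ Ico (0:ℝ) 1)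
    (hs : s < φ z) : z < pseudoInv φ s := by
  obtain ⟨w, hw, -, hw'⟩ := h.exists_gt_lt_apply hz hs hz.2
  exact hw.1.trans_le ((h.le_pseudoInv_iff ⟨hz.1.trans_lt hw.1, hw.2.le⟩).2 hw'.le)

lemma exists_realGen_eq (h : IsGenerator φ) {x t : ℝ} (hx : x ∈ Ioc (0:ℝ) 1) (ht : 0 < t)
    (htx : t ≤ realGen φ x) : ∃ u ∈ Ioo (0:ℝ) 1, realGen φ u = t := by
  have hlt : ENNReal.ofReal t < φ 0 := by
    refine lt_of_le_of_lt ?_ (h.strict_anti 0 ⟨le_rfl, zero_le_one⟩ x (Ioc_subset_Icc_self hx) hx.1)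
    rw [← h.ofReal_realGen hx]
    exact ENNReal.ofReal_le_ofReal htx
  have heq := h.apply_pseudoInv hlt.le
  refine ⟨_, ⟨h.lt_pseudoInv ⟨le_rfl, zero_lt_one⟩ hlt, ?_⟩, ?_⟩
  · rw [h.pseudoInv_lt_iff ⟨zero_lt_one, le_rfl⟩, h.map_one]
    exact ENNReal.ofReal_pos.2 ht
  · rw [realGen, heq, ENNReal.toReal_ofReal ht.le]

lemma tendsto_pseudoInv {ι : Type*} {l : Filter ι} (h : IsGenerator φ) {ψ : ι → ℝ → ℝ≥0∞}
    (hψ : ∀ i, IsGenerator (ψ i))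
    (hlim : ∀ z ∈ Ioc (0:ℝ) 1, Tendsto (fun i => ψ i z) l (nhds (φ z)))
    {s : ι → ℝ≥0∞} {s₀ : ℝ≥0∞} (hs : Tendsto s l (nhds s₀)) :
    Tendsto (fun i => pseudoInv (ψ i) (s i)) l (nhds (pseudoInv φ s₀)) := by
  refine tendsto_order.2 ⟨fun a ha => ?_, fun a ha => ?_⟩
  · rcases lt_or_ge a 0 with ha0 | ha0
    · exact Eventually.of_forall fun i => ha0.trans_le (pseudoInv_nonneg _ _)
    obtain ⟨b, hab, hb⟩ := exists_between ha
    obtain ⟨c, hbc, hc⟩ := exists_between hb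
    have hc1 : c < 1 := hc.trans_le (pseudoInv_le_one _ _)
    have hbm : b ∈ Ioc (0:ℝ) 1 := ⟨ha0.trans_lt hab, (hbc.trans hc1).le⟩
    have hcm : c ∈ Ioc (0:ℝ) 1 := ⟨hbm.1.trans hbc, hc1.le⟩
    have hlt : s₀ < φ b := ((h.le_pseudoInv_iff hcm).1 hc.le).trans_lt
      (h.strict_anti _ (Ioc_subset_Icc_self hbm) _ (Ioc_subset_Icc_self hcm) hbc)
    filter_upwards [hs.eventually_lt (hlim b hbm) hlt] with i hi
    exact hab.trans_le (((hψ i).le_pseudoInv_iff hbm).2 hi.le)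
  · rcases lt_or_ge 1 a with ha1 | ha1
    · exact Eventually.of_forall fun i => (pseudoInv_le_one _ _).trans_lt ha1
    have ham : a ∈ Ioc (0:ℝ) 1 := ⟨(pseudoInv_nonneg _ _).trans_lt ha, ha1⟩
    filter_upwards [(hlim a ham).eventually_lt hs ((h.pseudoInv_lt_iff ham).1 ha)] with i hi
    exact ((hψ i).pseudoInv_lt_iff ham).2 hi

lemma continuous_pseudoInv (h : IsGenerator φ) : Continuous (pseudoInv φ) :=
  continuous_iff_continuousAt.2 fun _ =>
    h.tendsto_pseudoInv (fun _ => h) (fun _ _ => tendsto_const_nhds) tendsto_id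

lemma Dplus_eq (φ : ℝ → ℝ≥0∞) (x : ℝ) : Dplus φ x = sInf (slope (realGen φ) x '' Ioc x 1) := by
  simp only [Dplus, rightD, slope_fun_def_field]
  rfl

lemma setOf_Ioc_eq {x : ℝ} (hx : 0 < x) : {y | y ∈ Ioc (0:ℝ) 1 ∧ x < y} = Ioc x 1 := by
  ext y
  exact ⟨fun hy => ⟨hy.2, hy.1.2⟩, fun hy => ⟨⟨hx.trans hy.1, hy.2⟩, hy.1⟩⟩

lemma mem_interior_Ioc {x : ℝ} (hx : x ∈ Ioo (0:ℝ) 1) : x ∈ interior (Ioc (0:ℝ) 1) := by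
  rwa [interior_Ioc]

lemma hasDerivWithinAt_Dplus (h : IsGenerator φ) {x : ℝ} (hx : x ∈ Ioo (0:ℝ) 1) :
    HasDerivWithinAt (realGen φ) (Dplus φ x) (Ioi x) x := by
  rw [Dplus_eq, ← setOf_Ioc_eq hx.1]
  exact h.convexOn_realGen.hasDerivWithinAt_sInf_slope_of_mem_interior (mem_interior_Ioc hx)

lemma Dplus_le_slope (h : IsGenerator φ) {x y : ℝ} (hx : x ∈ Ioo (0:ℝ) 1) (hy : y ∈ Ioc x 1) :
    Dplus φ x ≤ (realGen φ y - realGen φ x) / (y - x) := by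
  have hb := bddBelow_slope_lt_of_mem_interior h.convexOn_realGen (mem_interior_Ioc hx)
  rw [setOf_Ioc_eq hx.1] at hb
  rw [Dplus_eq, ← slope_def_field]
  exact csInf_le hb (mem_image_of_mem _ hy)

lemma Dplus_eq_zero_or_le_slope {x y : ℝ} (hy : y ∈ Ioc x 1) :
    Dplus φ x = 0 ∨ Dplus φ x ≤ (realGen φ y - realGen φ x) / (y - x) := by
  rw [Dplus_eq]
  by_cases hb : BddBelow (slope (realGen φ) x '' Ioc x 1)
  · right
    rw [← slope_def_field]
    exact csInf_le hb (mem_image_of_mem _ hy)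
  · exact Or.inl (Real.sInf_of_not_bddBelow hb)

lemma slope_le_Dplus (h : IsGenerator φ) {w x : ℝ} (hw : 0 < w) (hwx : w < x) (hx : x < 1) :
    (realGen φ x - realGen φ w) / (x - w) ≤ Dplus φ x := by
  rw [Dplus_eq]
  refine le_csInf ((nonempty_Ioc.2 hx).image _) ?_
  rintro _ ⟨y, hy, rfl⟩
  rw [slope_def_field]
  exact h.convexOn_realGen.slope_mono_adjacent ⟨hw, (hwx.trans hx).le⟩
    ⟨(hw.trans hwx).trans hy.1, hy.2⟩ hwx hy.1

lemma Dplus_neg (h : IsGenerator φ) {x : ℝ} (hx : x ∈ Ioo (0:ℝ) 1) : Dplus φ x < 0 := by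
  refine (h.Dplus_le_slope hx ⟨hx.2, le_rfl⟩).trans_lt (div_neg_of_neg_of_pos ?_ (sub_pos.2 hx.2))
  exact sub_neg.2 (h.strictAntiOn_realGen (Ioo_subset_Ioc_self hx) ⟨zero_lt_one, le_rfl⟩ hx.2)

lemma monotoneOn_Dplus (h : IsGenerator φ) : MonotoneOn (Dplus φ) (Ioo 0 1) := by
  intro x hx y hy hxy
  rcases hxy.eq_or_lt with rfl | hlt
  · exact le_rfl
  · exact (h.Dplus_le_slope hx ⟨hlt, hy.2.le⟩).trans (h.slope_le_Dplus hx.1 hlt hy.2)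

lemma Dplus_zero_of_top (h : IsGenerator φ) (h0 : φ 0 = ⊤) : Dplus φ 0 = 0 := by
  have hz : realGen φ 0 = 0 := by simp [realGen, h0]
  rw [Dplus_eq]
  refine le_antisymm (csInf_le ⟨0, ?_⟩ ⟨1, ⟨zero_lt_one, le_rfl⟩, ?_⟩) (Real.sInf_nonneg ?_)
  · rintro _ ⟨y, hy, rfl⟩
    rw [slope_def_field, hz, sub_zero, sub_zero]
    exact div_nonneg (realGen_nonneg y) hy.1.le
  · rw [slope_def_field, hz, h.realGen_one]
    simp
  · rintro _ ⟨y, hy, rfl⟩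
    rw [slope_def_field, hz, sub_zero, sub_zero]
    exact div_nonneg (realGen_nonneg y) hy.1.le

lemma lt_levelFn_iff (h : IsGenerator φ) {x y : ℝ} (hx : x ∈ Ioc (0:ℝ) 1)
    (hy : y ∈ Ioc (0:ℝ) 1) : y < levelFn φ 0 x ↔ φ 0 < φ x + φ y := by
  have hfin := (h.finite x hx).ne
  constructor
  · intro hlt
    obtain ⟨z, hyz, hz⟩ := exists_between hlt
    have hzm : z ∈ Ioc (0:ℝ) 1 := ⟨hy.1.trans hyz, hz.le.trans (pseudoInv_le_one _ _)⟩
    have h1 := (h.le_pseudoInv_iff hzm).1 hz.le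
    rw [tsub_le_iff_left] at h1
    exact h1.trans_lt ((ENNReal.add_lt_add_iff_left hfin).2
      (h.strict_anti y (Ioc_subset_Icc_self hy) z (Ioc_subset_Icc_self hzm) hyz))
  · intro hlt
    have hx0 : φ x ≤ φ 0 := h.antitoneOn ⟨le_rfl, zero_le_one⟩ (Ioc_subset_Icc_self hx) hx.1.le
    have hy1 : y < 1 := by
      refine lt_of_le_of_ne hy.2 ?_
      rintro rfl
      rw [h.map_one, add_zero] at hlt
      exact hlt.not_ge hx0
    refine h.lt_pseudoInv ⟨hy.1.le, hy1⟩ ?_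
    exact (ENNReal.sub_lt_iff_lt_left hfin hx0).2 hlt

lemma archKernel_of_lt (h : IsGenerator φ) {x y : ℝ} (hx : x ∈ Ioo (0:ℝ) 1)
    (hy : y ∈ Ioc (0:ℝ) 1) (hlt : φ 0 < φ x + φ y) : archKernel φ x y = 0 := by
  rw [archKernel, if_neg (not_or.2 ⟨hx.1.ne', hx.2.ne⟩),
    if_pos ((h.lt_levelFn_iff (Ioo_subset_Ioc_self hx) hy).2 hlt)]

lemma archKernel_of_le (h : IsGenerator φ) {x y : ℝ} (hx : x ∈ Ioo (0:ℝ) 1)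
    (hy : y ∈ Ioc (0:ℝ) 1) (hle : φ x + φ y ≤ φ 0) :
    archKernel φ x y = Dplus φ x / Dplus φ (archCopula φ x y) := by
  rw [archKernel, if_neg (not_or.2 ⟨hx.1.ne', hx.2.ne⟩),
    if_neg (fun hc => ((h.lt_levelFn_iff (Ioo_subset_Ioc_self hx) hy).1 hc).not_ge hle)]

lemma archKernel_zero (h : IsGenerator φ) {x : ℝ} (hx : x ∈ Ioo (0:ℝ) 1) :
    archKernel φ x 0 = 0 := by
  rw [archKernel, if_neg (not_or.2 ⟨hx.1.ne', hx.2.ne⟩)]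
  split_ifs with h0
  · rfl
  have htop : φ 0 = ⊤ := by
    by_contra hne
    refine h0 (h.lt_pseudoInv ⟨le_rfl, zero_lt_one⟩ (ENNReal.sub_lt_self hne ?_ ?_))
    · exact (zero_lt_one.trans h.one_lt_apply_zero).ne'
    · rw [← h.map_one]
      exact (h.strict_anti x ⟨hx.1.le, hx.2.le⟩ 1 ⟨zero_le_one, le_rfl⟩ hx.2).ne'
  have hC : archCopula φ x 0 = 0 := by
    refine le_antisymm (not_lt.1 fun hpos => ?_) (pseudoInv_nonneg _ _)
    have hm : archCopula φ x 0 ∈ Ioc (0:ℝ) 1 := ⟨hpos, pseudoInv_le_one _ _⟩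
    have h1 := (h.le_pseudoInv_iff hm).1 le_rfl
    rw [htop, add_top, top_le_iff] at h1
    exact (h.finite _ hm).ne h1
  rw [hC, h.Dplus_zero_of_top htop, div_zero]

lemma archCopula_one (h : IsGenerator φ) {x : ℝ} (hx : x ∈ Ioc (0:ℝ) 1) :
    archCopula φ x 1 = x := by
  rw [archCopula, h.map_one, add_zero, h.pseudoInv_apply hx]

lemma archKernel_one (h : IsGenerator φ) {x : ℝ} (hx : x ∈ Ioo (0:ℝ) 1) :
    archKernel φ x 1 = 1 := by
  have hx' := Ioo_subset_Ioc_self hx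
  rw [h.archKernel_of_le hx ⟨zero_lt_one, le_rfl⟩, h.archCopula_one hx',
    div_self (h.Dplus_neg hx).ne]
  rw [h.map_one, add_zero]
  exact h.antitoneOn ⟨le_rfl, zero_le_one⟩ (Ioc_subset_Icc_self hx') hx.1.le

lemma archCopula_mem (h : IsGenerator φ) {x y : ℝ} (hx : x ∈ Ioo (0:ℝ) 1)
    (hlt : φ x + φ y < φ 0) : archCopula φ x y ∈ Ioo (0:ℝ) 1 := by
  refine ⟨h.lt_pseudoInv ⟨le_rfl, zero_lt_one⟩ hlt, ?_⟩
  refine ((h.pseudoInv_lt_iff ⟨zero_lt_one, le_rfl⟩).2 ?_)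
  refine lt_of_lt_of_le ?_ le_self_add
  exact h.strict_anti x ⟨hx.1.le, hx.2.le⟩ 1 ⟨zero_le_one, le_rfl⟩ hx.2

lemma archCopula_eq_zero (h : IsGenerator φ) {x y : ℝ} (hle : φ 0 ≤ φ x + φ y) :
    archCopula φ x y = 0 := by
  refine le_antisymm (not_lt.1 fun hpos => ?_) (pseudoInv_nonneg _ _)
  have hm : archCopula φ x y ∈ Ioc (0:ℝ) 1 := ⟨hpos, pseudoInv_le_one _ _⟩
  have h1 := (h.le_pseudoInv_iff hm).1 le_rfl
  exact (hle.trans h1).not_gt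
    (h.strict_anti 0 ⟨le_rfl, zero_le_one⟩ _ (Ioc_subset_Icc_self hm) hpos)

lemma realGen_archCopula (h : IsGenerator φ) {x y : ℝ} (hx : x ∈ Ioc (0:ℝ) 1)
    (hy : y ∈ Ioc (0:ℝ) 1) (hle : φ x + φ y ≤ φ 0) :
    realGen φ (archCopula φ x y) = realGen φ x + realGen φ y := by
  rw [realGen, archCopula, h.apply_pseudoInv hle,
    ENNReal.toReal_add (h.finite x hx).ne (h.finite y hy).ne]
  rfl

lemma continuousOn_archCopula_right (h : IsGenerator φ) (x : ℝ) :
    ContinuousOn (archCopula φ x) (Icc 0 1) :=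
  h.continuous_pseudoInv.comp_continuousOn (continuousOn_const.add h.continuousOn)

lemma continuousOn_archCopula_left (h : IsGenerator φ) (y : ℝ) :
    ContinuousOn (fun x => archCopula φ x y) (Icc 0 1) :=
  h.continuous_pseudoInv.comp_continuousOn (h.continuousOn.add continuousOn_const)

section Convergence

variable {φseq : ℕ → ℝ → ℝ≥0∞}

lemma tendsto_realGen (h : IsGenerator φ) {x : ℝ} (hx : x ∈ Ioc (0:ℝ) 1)
    (hlim : Tendsto (fun n => φseq n x) atTop (nhds (φ x))) :
    Tendsto (fun n => realGen (φseq n) x) atTop (nhds (realGen φ x)) :=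
  (ENNReal.tendsto_toReal (h.finite x hx).ne).comp hlim

/-- Right derivatives of converging generators converge along converging points, as soon as the
limiting right derivative is approximated from both sides at the limit point. -/
lemma tendsto_Dplus (h : IsGenerator φ) (hseq : ∀ n, IsGenerator (φseq n))
    (hlim : ∀ x ∈ Ioc (0:ℝ) 1, Tendsto (fun n => φseq n x) atTop (nhds (φ x)))
    {c : ℕ → ℝ} {z : ℝ} (hz : z ∈ Ioo (0:ℝ) 1) (hc : Tendsto c atTop (nhds z))
    (hub : ∀ u, Dplus φ z < u → ∃ b ∈ Ioo z 1, Dplus φ b < u)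
    (hlb : ∀ u, u < Dplus φ z → ∃ a ∈ Ioo 0 z, u < Dplus φ a) :
    Tendsto (fun n => Dplus (φseq n) (c n)) atTop (nhds (Dplus φ z)) := by
  have hslope : ∀ a ∈ Ioc (0:ℝ) 1, ∀ b ∈ Ioc (0:ℝ) 1,
      Tendsto (fun n => (realGen (φseq n) b - realGen (φseq n) a) / (b - a)) atTop
        (nhds ((realGen φ b - realGen φ a) / (b - a))) := fun a ha b hb =>
    ((h.tendsto_realGen hb (hlim b hb)).sub (h.tendsto_realGen ha (hlim a ha))).div_const _
  refine tendsto_order.2 ⟨fun u hu => ?_, fun u hu => ?_⟩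
  · obtain ⟨a, ha, hau⟩ := hlb u hu
    obtain ⟨b, hab, hbz⟩ := exists_between ha.2
    have hb : b ∈ Ioo (0:ℝ) 1 := ⟨ha.1.trans hab, hbz.trans hz.2⟩
    have ham : a ∈ Ioo (0:ℝ) 1 := ⟨ha.1, hab.trans hb.2⟩
    have hlt := hau.trans_le (h.Dplus_le_slope ham ⟨hab, hb.2.le⟩)
    filter_upwards [hc.eventually (lt_mem_nhds hbz), hc.eventually (gt_mem_nhds hz.2),
      (hslope a (Ioo_subset_Ioc_self ham) b (Ioo_subset_Ioc_self hb)).eventually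
        (lt_mem_nhds hlt)] with n h1 h2 h3
    exact h3.trans_le (((hseq n).slope_le_Dplus ham.1 hab hb.2).trans
      ((hseq n).monotoneOn_Dplus hb ⟨hb.1.trans h1, h2⟩ h1.le))
  · obtain ⟨b, hb, hbu⟩ := hub u hu
    obtain ⟨a, hza, hab⟩ := exists_between hb.1
    have ha : a ∈ Ioo (0:ℝ) 1 := ⟨hz.1.trans hza, hab.trans hb.2⟩
    have hbm : b ∈ Ioo (0:ℝ) 1 := ⟨ha.1.trans hab, hb.2⟩
    have hlt := (h.slope_le_Dplus ha.1 hab hb.2).trans_lt hbu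
    filter_upwards [hc.eventually (gt_mem_nhds hza), hc.eventually (lt_mem_nhds hz.1),
      (hslope a (Ioo_subset_Ioc_self ha) b (Ioo_subset_Ioc_self hbm)).eventually
        (gt_mem_nhds hlt)] with n h1 h2 h3
    exact (((hseq n).monotoneOn_Dplus ⟨h2, h1.trans ha.2⟩ ha h1.le).trans
      ((hseq n).Dplus_le_slope ha ⟨hab, hb.2.le⟩)).trans_lt h3

lemma tendsto_Dplus_of_continuousAt (h : IsGenerator φ) (hseq : ∀ n, IsGenerator (φseq n))
    (hlim : ∀ x ∈ Ioc (0:ℝ) 1, Tendsto (fun n => φseq n x) atTop (nhds (φ x)))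
    {x : ℝ} (hx : x ∈ ContD φ) :
    Tendsto (fun n => Dplus (φseq n) x) atTop (nhds (Dplus φ x)) := by
  refine h.tendsto_Dplus hseq hlim hx.1 tendsto_const_nhds (fun u hu => ?_) (fun u hu => ?_)
  · have hev : ∀ᶠ t in nhdsWithin x (Ioo x 1), Dplus φ t < u :=
      nhdsWithin_le_nhds (hx.2.eventually (gt_mem_nhds hu))
    have := left_nhdsWithin_Ioo_neBot hx.1.2
    obtain ⟨t, ht, htm⟩ := (hev.and self_mem_nhdsWithin).exists
    exact ⟨t, htm, ht⟩
  · have hev : ∀ᶠ t in nhdsWithin x (Ioo 0 x), u < Dplus φ t :=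
      nhdsWithin_le_nhds (hx.2.eventually (lt_mem_nhds hu))
    have := right_nhdsWithin_Ioo_neBot hx.1.1
    obtain ⟨t, ht, htm⟩ := (hev.and self_mem_nhdsWithin).exists
    exact ⟨t, htm, ht⟩

lemma tendsto_archCopula (h : IsGenerator φ) (hseq : ∀ n, IsGenerator (φseq n))
    (hlim : ∀ x ∈ Ioc (0:ℝ) 1, Tendsto (fun n => φseq n x) atTop (nhds (φ x)))
    {x y : ℝ} (hx : x ∈ Ioc (0:ℝ) 1) (hy : y ∈ Ioc (0:ℝ) 1) :
    Tendsto (fun n => archCopula (φseq n) x y) atTop (nhds (archCopula φ x y)) :=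
  h.tendsto_pseudoInv hseq hlim ((hlim x hx).add (hlim y hy))

lemma archCopula_lt_archCopula (h : IsGenerator φ) {x y z : ℝ} (hx : x ∈ Ioo (0:ℝ) 1)
    (hy : y ∈ Ioc (0:ℝ) 1) (hz : z ∈ Ioc (0:ℝ) 1) (hyz : y < z) (hlt : φ x + φ y < φ 0) :
    archCopula φ x y < archCopula φ x z := by
  have hm := h.archCopula_mem hx hlt
  refine h.lt_pseudoInv ⟨hm.1.le, hm.2⟩ ?_
  rw [archCopula, h.apply_pseudoInv hlt.le]
  exact (ENNReal.add_lt_add_iff_left (h.finite x (Ioo_subset_Ioc_self hx)).ne).2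
    (h.strict_anti y (Ioc_subset_Icc_self hy) z (Ioc_subset_Icc_self hz) hyz)

lemma continuousAt_apply (h : IsGenerator φ) {x : ℝ} (hx : x ∈ Ioo (0:ℝ) 1) :
    ContinuousAt φ x :=
  h.continuousOn.continuousAt (Icc_mem_nhds hx.1 hx.2)

lemma eventually_add_lt (h : IsGenerator φ) {x y : ℝ} (hy : y ∈ Ioo (0:ℝ) 1)
    (hlt : φ x + φ y < φ 0) : ∀ᶠ t in nhds y, t ∈ Ioo (0:ℝ) 1 ∧ φ x + φ t < φ 0 :=
  (isOpen_Ioo.eventually_mem hy).and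
    ((tendsto_const_nhds.add (h.continuousAt_apply hy)).eventually (gt_mem_nhds hlt))

lemma tendsto_archKernel_of_add_lt (h : IsGenerator φ) (hseq : ∀ n, IsGenerator (φseq n))
    (hlim : ∀ x ∈ Ioc (0:ℝ) 1, Tendsto (fun n => φseq n x) atTop (nhds (φ x)))
    {x y : ℝ} (hx : x ∈ Ioo (0:ℝ) 1) (hy : y ∈ Ioo (0:ℝ) 1)
    (hDx : Tendsto (fun n => Dplus (φseq n) x) atTop (nhds (Dplus φ x)))
    (hlt : φ x + φ y < φ 0) (hcont : ContinuousAt (fun t => archKernel φ x t) y) :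
    Tendsto (fun n => archKernel (φseq n) x y) atTop (nhds (archKernel φ x y)) := by
  have hx' := Ioo_subset_Ioc_self hx
  have hy' := Ioo_subset_Ioc_self hy
  have hm := h.archCopula_mem hx hlt
  have hK : archKernel φ x y = Dplus φ x / Dplus φ (archCopula φ x y) :=
    h.archKernel_of_le hx hy' hlt.le
  have hK0 : archKernel φ x y ≠ 0 := by
    rw [hK]
    exact div_ne_zero (h.Dplus_neg hx).ne (h.Dplus_neg hm).ne
  have hev := h.eventually_add_lt hy hlt
  have hcontD : ContinuousAt (fun t => Dplus φ (archCopula φ x t)) y := by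
    have : ContinuousAt (fun t => Dplus φ x / archKernel φ x t) y :=
      continuousAt_const.div hcont hK0
    refine this.congr ?_
    filter_upwards [hev] with t ht
    rw [h.archKernel_of_le hx (Ioo_subset_Ioc_self ht.1) ht.2.le,
      div_div_cancel₀ (h.Dplus_neg hx).ne]
  have hD : Tendsto (fun n => Dplus (φseq n) (archCopula (φseq n) x y)) atTop
      (nhds (Dplus φ (archCopula φ x y))) := by
    refine h.tendsto_Dplus hseq hlim hm (h.tendsto_archCopula hseq hlim hx' hy')
      (fun u hu => ?_) (fun u hu => ?_)
    · have hev2 : ∀ᶠ t in nhdsWithin y (Ioo y 1), _ :=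
        nhdsWithin_le_nhds ((hcontD.eventually (gt_mem_nhds hu)).and hev)
      have := left_nhdsWithin_Ioo_neBot hy.2
      obtain ⟨t, ⟨ht1, ht2⟩, ht3⟩ := (hev2.and self_mem_nhdsWithin).exists
      exact ⟨_, ⟨h.archCopula_lt_archCopula hx hy' (Ioo_subset_Ioc_self ht2.1) ht3.1 hlt,
        (h.archCopula_mem hx ht2.2).2⟩, ht1⟩
    · have hev2 : ∀ᶠ t in nhdsWithin y (Ioo 0 y), _ :=
        nhdsWithin_le_nhds ((hcontD.eventually (lt_mem_nhds hu)).and hev)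
      have := right_nhdsWithin_Ioo_neBot hy.1
      obtain ⟨t, ⟨ht1, ht2⟩, ht3⟩ := (hev2.and self_mem_nhdsWithin).exists
      exact ⟨_, ⟨(h.archCopula_mem hx ht2.2).1,
        h.archCopula_lt_archCopula hx (Ioo_subset_Ioc_self ht2.1) hy' ht3.2 ht2.2⟩, ht1⟩
  rw [hK]
  refine (hDx.div hD (h.Dplus_neg hm).ne).congr' ?_
  have hpos := (h.tendsto_archCopula hseq hlim hx' hy').eventually (lt_mem_nhds hm.1)
  filter_upwards [hpos] with n hn
  refine ((hseq n).archKernel_of_le hx hy' (not_lt.1 fun hc => ?_)).symm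
  rw [(hseq n).archCopula_eq_zero hc.le] at hn
  exact lt_irrefl _ hn

lemma exists_slope_lt (h : IsGenerator φ) {x y : ℝ} (hx : x ∈ Ioo (0:ℝ) 1)
    (hy : y ∈ Ioc (0:ℝ) 1) (hle : φ 0 ≤ φ x + φ y) (hK : archKernel φ x y = 0) {M : ℝ}
    (hM : 0 < M) : ∃ ε ∈ Ioc (0:ℝ) 1, (realGen φ ε - (realGen φ x + realGen φ y)) / ε < -M := by
  have hx' := Ioo_subset_Ioc_self hx
  have hsum : (φ x + φ y).toReal = realGen φ x + realGen φ y :=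
    ENNReal.toReal_add (h.finite x hx').ne (h.finite y hy).ne
  have hsum_ne_top : φ x + φ y ≠ ⊤ := ENNReal.add_ne_top.2 ⟨(h.finite x hx').ne, (h.finite y hy).ne⟩
  have h0top : φ 0 ≠ ⊤ := ne_top_of_le_ne_top hsum_ne_top hle
  rcases hle.lt_or_eq with hlt | heq
  · have hlt' : realGen φ 0 < realGen φ x + realGen φ y := by
      rw [← hsum]
      exact (ENNReal.toReal_lt_toReal h0top hsum_ne_top).2 hlt
    set δ := realGen φ x + realGen φ y - realGen φ 0 with hδ
    have hδ0 : 0 < δ := sub_pos.2 hlt'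
    have hε0 : 0 < min 1 (δ / (2 * M)) := by positivity
    refine ⟨min 1 (δ / (2 * M)), ⟨hε0, min_le_left _ _⟩, ?_⟩
    have hε1 : min 1 (δ / (2 * M)) * (2 * M) ≤ δ :=
      (le_div_iff₀ (by positivity)).1 (min_le_right _ _)
    have hmono : realGen φ (min 1 (δ / (2 * M))) ≤ realGen φ 0 :=
      ENNReal.toReal_mono h0top
        (h.antitoneOn ⟨le_rfl, zero_le_one⟩ ⟨hε0.le, min_le_left _ _⟩ hε0.le)
    rw [div_lt_iff₀ hε0]
    nlinarith [mul_pos hε0 hM]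
  · have heq' : realGen φ 0 = realGen φ x + realGen φ y := by
      rw [← hsum, ← heq]
      rfl
    by_contra! hcon
    rw [← heq'] at hcon
    rw [h.archKernel_of_le hx hy heq.ge, h.archCopula_eq_zero hle, div_eq_zero_iff] at hK
    have hD0 := hK.resolve_left (h.Dplus_neg hx).ne
    have hb : BddBelow (slope (realGen φ) 0 '' Ioc 0 1) := by
      refine ⟨-M, ?_⟩
      rintro _ ⟨ε, hε, rfl⟩
      rw [slope_def_field, sub_zero]
      exact hcon ε hε
    have hle1 := csInf_le hb (mem_image_of_mem _ (show (1:ℝ) ∈ Ioc 0 1 by simp))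
    rw [← Dplus_eq, hD0, slope_def_field, h.realGen_one] at hle1
    have : 0 < realGen φ 0 :=
      ENNReal.toReal_pos (zero_lt_one.trans h.one_lt_apply_zero).ne' h0top
    linarith

lemma tendsto_archKernel_zero (h : IsGenerator φ) (hseq : ∀ n, IsGenerator (φseq n))
    (hlim : ∀ x ∈ Ioc (0:ℝ) 1, Tendsto (fun n => φseq n x) atTop (nhds (φ x)))
    {x y : ℝ} (hx : x ∈ Ioo (0:ℝ) 1) (hy : y ∈ Ioc (0:ℝ) 1)
    (hDx : Tendsto (fun n => Dplus (φseq n) x) atTop (nhds (Dplus φ x)))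
    (hle : φ 0 ≤ φ x + φ y) (hK : archKernel φ x y = 0) :
    Tendsto (fun n => archKernel (φseq n) x y) atTop (nhds 0) := by
  have hx' := Ioo_subset_Ioc_self hx
  refine Metric.tendsto_nhds.2 fun η hη => ?_
  have hA : 0 < |Dplus φ x| + 1 := by positivity
  obtain ⟨ε, hε, hεlt⟩ := h.exists_slope_lt hx hy hle hK (div_pos hA hη)
  have hC := h.tendsto_archCopula hseq hlim hx' hy
  rw [h.archCopula_eq_zero hle] at hC
  have hsl : Tendsto (fun n => (realGen (φseq n) ε - (realGen (φseq n) x + realGen (φseq n) y)) /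
      (ε - archCopula (φseq n) x y)) atTop
      (nhds ((realGen φ ε - (realGen φ x + realGen φ y)) / (ε - 0))) :=
    ((h.tendsto_realGen hε (hlim ε hε)).sub ((h.tendsto_realGen hx' (hlim x hx')).add
      (h.tendsto_realGen hy (hlim y hy)))).div (tendsto_const_nhds.sub hC)
      (by simpa using hε.1.ne')
  rw [sub_zero] at hsl
  filter_upwards [hC.eventually (gt_mem_nhds hε.1), hsl.eventually (gt_mem_nhds hεlt),
    hDx.abs.eventually (gt_mem_nhds (lt_add_one |Dplus φ x|))] with n h1 h2 h3
  rw [Real.dist_eq, sub_zero]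
  rcases lt_or_ge (φseq n 0) (φseq n x + φseq n y) with hlt | hge
  · rwa [(hseq n).archKernel_of_lt hx hy hlt, abs_zero]
  rw [(hseq n).archKernel_of_le hx hy hge]
  rcases Dplus_eq_zero_or_le_slope (φ := φseq n) ⟨h1, hε.2⟩ with h0 | h4
  · rwa [h0, div_zero, abs_zero]
  rw [(hseq n).realGen_archCopula hx' hy hge] at h4
  have h5 : (|Dplus φ x| + 1) / η < |Dplus (φseq n) (archCopula (φseq n) x y)| := by
    refine lt_of_lt_of_le ?_ (neg_le_abs _)
    linarith
  rw [abs_div, div_lt_iff₀ ((div_pos hA hη).trans h5)]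
  rw [div_lt_iff₀ hη] at h5
  linarith

lemma countable_not_continuousAt_Dplus (h : IsGenerator φ) :
    {x | x ∈ Ioo (0:ℝ) 1 ∧ ¬ ContinuousAt (Dplus φ) x}.Countable := by
  refine h.monotoneOn_Dplus.countable_not_continuousWithinAt.mono ?_
  rintro x ⟨hx, hc⟩
  exact ⟨hx, fun hw => hc (hw.continuousAt (Ioo_mem_nhds hx.1 hx.2))⟩

lemma ae_mem_ContD (h : IsGenerator φ) :
    ∀ᵐ x ∂(volume.restrict (Icc (0:ℝ) 1)), x ∈ ContD φ := by
  have h1 := h.countable_not_continuousAt_Dplus.ae_notMem (volume.restrict (Icc (0:ℝ) 1))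
  have h2 := (countable_singleton (0:ℝ)).ae_notMem (volume.restrict (Icc (0:ℝ) 1))
  have h3 := (countable_singleton (1:ℝ)).ae_notMem (volume.restrict (Icc (0:ℝ) 1))
  filter_upwards [h1, h2, h3, ae_restrict_mem measurableSet_Icc] with x hx1 hx2 hx3 hx4
  have hx : x ∈ Ioo (0:ℝ) 1 := ⟨lt_of_le_of_ne hx4.1 (Ne.symm hx2), lt_of_le_of_ne hx4.2 hx3⟩
  exact ⟨hx, by_contra fun hc => hx1 ⟨hx, hc⟩⟩

lemma archKernel_eq_zero_of_continuousAt (h : IsGenerator φ) {x y : ℝ} (hx : x ∈ Ioo (0:ℝ) 1)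
    (hy : y ∈ Ioo (0:ℝ) 1) (hle : φ 0 ≤ φ x + φ y)
    (hcont : ContinuousAt (fun t => archKernel φ x t) y) : archKernel φ x y = 0 := by
  have hev : (fun t => archKernel φ x t) =ᶠ[nhdsWithin y (Ioo 0 y)] fun _ => 0 := by
    filter_upwards [self_mem_nhdsWithin] with t ht
    have htm : t ∈ Ioc (0:ℝ) 1 := ⟨ht.1, (ht.2.trans hy.2).le⟩
    refine h.archKernel_of_lt hx htm (hle.trans_lt ?_)
    exact (ENNReal.add_lt_add_iff_left (h.finite x (Ioo_subset_Ioc_self hx)).ne).2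
      (h.strict_anti t (Ioc_subset_Icc_self htm) y ⟨hy.1.le, hy.2.le⟩ ht.2)
  have := right_nhdsWithin_Ioo_neBot hy.1
  exact tendsto_nhds_unique (hcont.tendsto.mono_left nhdsWithin_le_nhds)
    (tendsto_const_nhds.congr' hev.symm)

theorem weakCondConv_of_tendsto (h : IsGenerator φ) (hseq : ∀ n, IsGenerator (φseq n))
    (hlim : ∀ x ∈ Ioc (0:ℝ) 1, Tendsto (fun n => φseq n x) atTop (nhds (φ x))) :
    WeakCondConv (fun n => archKernel (φseq n)) (archKernel φ) := by
  filter_upwards [h.ae_mem_ContD] with x hxD y hy hcont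
  have hx := hxD.1
  rcases hy.1.eq_or_lt with rfl | hy0
  · simp only [h.archKernel_zero hx, (hseq _).archKernel_zero hx]
    exact tendsto_const_nhds
  rcases hy.2.eq_or_lt with rfl | hy1
  · simp only [h.archKernel_one hx, (hseq _).archKernel_one hx]
    exact tendsto_const_nhds
  have hcont' := hcont.continuousAt (Icc_mem_nhds hy0 hy1)
  have hDx := h.tendsto_Dplus_of_continuousAt hseq hlim hxD
  rcases lt_or_ge (φ x + φ y) (φ 0) with hlt | hge
  · exact h.tendsto_archKernel_of_add_lt hseq hlim hx ⟨hy0, hy1⟩ hDx hlt hcont'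
  · have hK := h.archKernel_eq_zero_of_continuousAt hx ⟨hy0, hy1⟩ hge hcont'
    rw [hK]
    exact h.tendsto_archKernel_zero hseq hlim hx ⟨hy0, hy1.le⟩ hDx hge hK

lemma archCopula_comm (φ : ℝ → ℝ≥0∞) (x y : ℝ) : archCopula φ x y = archCopula φ y x := by
  rw [archCopula, archCopula, add_comm]

lemma levelFn_lt_iff (h : IsGenerator φ) {x y : ℝ} (hx : x ∈ Ioc (0:ℝ) 1) :
    levelFn φ 0 y < x ↔ φ x + φ y < φ 0 := by
  rw [levelFn, h.pseudoInv_lt_iff hx, lt_tsub_iff_right]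

lemma hasDerivWithinAt_archCopula (h : IsGenerator φ) {x y : ℝ} (hx : x ∈ Ioo (0:ℝ) 1)
    (hy : y ∈ Ioo (0:ℝ) 1) (hne : x ≠ levelFn φ 0 y) :
    HasDerivWithinAt (fun s => archCopula φ s y) (archKernel φ x y) (Ioi x) x := by
  have hx' := Ioo_subset_Ioc_self hx
  have hy' := Ioo_subset_Ioc_self hy
  rcases lt_or_gt_of_ne hne with hlt | hgt
  · have hzero : ∀ t ∈ Ioo 0 (levelFn φ 0 y), φ 0 < φ t + φ y := fun t ht => by
      rw [add_comm]
      exact (h.lt_levelFn_iff hy' ⟨ht.1, ht.2.le.trans (pseudoInv_le_one _ _)⟩).1 ht.2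
    rw [h.archKernel_of_lt hx hy' (hzero x ⟨hx.1, hlt⟩)]
    refine HasDerivAt.hasDerivWithinAt ((hasDerivAt_const x (0:ℝ)).congr_of_eventuallyEq ?_)
    filter_upwards [Ioo_mem_nhds hx.1 hlt] with t ht
    exact h.archCopula_eq_zero (hzero t ht).le
  · have hpos := (h.levelFn_lt_iff hx').1 hgt
    have hm := h.archCopula_mem hx hpos
    rw [h.archKernel_of_le hx hy' hpos.le, hasDerivWithinAt_iff_tendsto_slope' self_notMem_Ioi]
    have hIoo : ∀ᶠ t in nhdsWithin x (Ioi x), t ∈ Ioo x 1 := Ioo_mem_nhdsGT hx.2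
    have hlt : ∀ᶠ t in nhdsWithin x (Ioi x), archCopula φ x y < archCopula φ t y := by
      filter_upwards [hIoo] with t ht
      rw [archCopula_comm φ x, archCopula_comm φ t]
      exact h.archCopula_lt_archCopula hy hx' ⟨hx.1.trans ht.1, ht.2.le⟩ ht.1 (by rwa [add_comm])
    have hC : Tendsto (fun t => archCopula φ t y) (nhdsWithin x (Ioi x))
        (nhdsWithin (archCopula φ x y) (Ioi (archCopula φ x y))) :=
      tendsto_nhdsWithin_iff.2 ⟨((h.continuousOn_archCopula_left y).continuousAt
        (Icc_mem_nhds hx.1 hx.2)).tendsto.mono_left nhdsWithin_le_nhds, hlt⟩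
    have h1 := (hasDerivWithinAt_iff_tendsto_slope' self_notMem_Ioi).1 (h.hasDerivWithinAt_Dplus hx)
    have h2 := ((hasDerivWithinAt_iff_tendsto_slope' self_notMem_Ioi).1
      (h.hasDerivWithinAt_Dplus hm)).comp hC
    refine (h1.div h2 (h.Dplus_neg hm).ne).congr' ?_
    filter_upwards [hIoo, hlt] with t ht htlt
    have htm : t ∈ Ioo (0:ℝ) 1 := ⟨hx.1.trans ht.1, ht.2⟩
    have htpos := (h.levelFn_lt_iff (Ioo_subset_Ioc_self htm)).1 (hgt.trans ht.1)
    have hCt := h.archCopula_mem htm htpos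
    have h3 := h.realGen_archCopula hx' hy' hpos.le
    have h4 := h.realGen_archCopula (Ioo_subset_Ioc_self htm) hy' htpos.le
    have h5 : realGen φ (archCopula φ t y) - realGen φ (archCopula φ x y) ≠ 0 :=
      (sub_neg.2 (h.strictAntiOn_realGen (Ioo_subset_Ioc_self hm)
        (Ioo_subset_Ioc_self hCt) htlt)).ne
    have h6 : realGen φ t - realGen φ x =
        realGen φ (archCopula φ t y) - realGen φ (archCopula φ x y) := by rw [h3, h4]; ring
    have h7 : t - x ≠ 0 := (sub_pos.2 ht.1).ne'
    have h8 : archCopula φ t y - archCopula φ x y ≠ 0 := (sub_pos.2 htlt).ne'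
    simp only [Pi.div_apply, Function.comp_apply, slope_def_field]
    rw [h6]
    field_simp

lemma abs_archKernel_le_one (h : IsGenerator φ) {x y : ℝ} (hx : x ∈ Ioo (0:ℝ) 1)
    (hy : y ∈ Ioo (0:ℝ) 1) (hne : x ≠ levelFn φ 0 y) : |archKernel φ x y| ≤ 1 := by
  have hx' := Ioo_subset_Ioc_self hx
  have hy' := Ioo_subset_Ioc_self hy
  rcases lt_or_gt_of_ne hne with hlt | hgt
  · rw [h.lt_levelFn_iff hy' hx', add_comm] at hlt
    rw [h.archKernel_of_lt hx hy' hlt, abs_zero]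
    exact zero_le_one
  · have hpos := (h.levelFn_lt_iff hx').1 hgt
    have hm := h.archCopula_mem hx hpos
    have hle : archCopula φ x y ≤ x := by
      refine (h.strictAntiOn_realGen.le_iff_ge hx' (Ioo_subset_Ioc_self hm)).1 ?_
      rw [h.realGen_archCopula hx' hy' hpos.le]
      exact le_add_of_nonneg_right (realGen_nonneg y)
    have hD := h.monotoneOn_Dplus hm hx hle
    rw [h.archKernel_of_le hx hy' hpos.le, abs_div, abs_of_neg (h.Dplus_neg hx),
      abs_of_neg (h.Dplus_neg hm), div_le_one (neg_pos.2 (h.Dplus_neg hm))]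
    exact neg_le_neg hD

lemma ae_mem_Ioo_ne (u : ℝ) :
    ∀ᵐ x ∂(volume.restrict (Icc (0:ℝ) 1)), x ∈ Ioo (0:ℝ) 1 ∧ x ≠ u := by
  have h1 := ({0, 1, u} : Set ℝ).toFinite.countable.ae_notMem (volume.restrict (Icc (0:ℝ) 1))
  filter_upwards [h1, ae_restrict_mem measurableSet_Icc] with x hx1 hx2
  simp only [mem_insert_iff, mem_singleton_iff, not_or] at hx1
  exact ⟨⟨lt_of_le_of_ne hx2.1 (Ne.symm hx1.1), lt_of_le_of_ne hx2.2 hx1.2.1⟩, hx1.2.2⟩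

lemma aestronglyMeasurable_archKernel (h : IsGenerator φ) {y : ℝ} (hy : y ∈ Ioo (0:ℝ) 1) :
    AEStronglyMeasurable (fun x => archKernel φ x y) (volume.restrict (Icc (0:ℝ) 1)) := by
  refine (aestronglyMeasurable_derivWithin_Ioi (fun s => archCopula φ s y) _).congr ?_
  filter_upwards [ae_mem_Ioo_ne (levelFn φ 0 y)] with x hx
  exact (h.hasDerivWithinAt_archCopula hx.1 hy hx.2).derivWithin (uniqueDiffWithinAt_Ioi x)

lemma ae_norm_archKernel_le (h : IsGenerator φ) {y : ℝ} (hy : y ∈ Ioo (0:ℝ) 1) :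
    ∀ᵐ x ∂(volume.restrict (Icc (0:ℝ) 1)), ‖archKernel φ x y‖ ≤ 1 := by
  filter_upwards [ae_mem_Ioo_ne (levelFn φ 0 y)] with x hx
  exact h.abs_archKernel_le_one hx.1 hy hx.2

lemma integrableOn_archKernel (h : IsGenerator φ) {y : ℝ} (hy : y ∈ Ioo (0:ℝ) 1) :
    IntegrableOn (fun x => archKernel φ x y) (Icc (0:ℝ) 1) :=
  Integrable.of_bound (h.aestronglyMeasurable_archKernel hy) 1 (h.ae_norm_archKernel_le hy)

lemma intervalIntegrable_archKernel (h : IsGenerator φ) {y : ℝ} (hy : y ∈ Ioo (0:ℝ) 1)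
    {a b : ℝ} (ha : a ∈ Icc (0:ℝ) 1) (hb : b ∈ Icc (0:ℝ) 1) :
    IntervalIntegrable (fun x => archKernel φ x y) volume a b := by
  refine IntegrableOn.intervalIntegrable ((h.integrableOn_archKernel hy).mono_set ?_)
  exact uIcc_subset_Icc ha hb

lemma integral_archKernel_eq_sub (h : IsGenerator φ) {y : ℝ} (hy : y ∈ Ioo (0:ℝ) 1)
    {a b : ℝ} (ha : 0 ≤ a) (hab : a ≤ b) (hb : b ≤ 1) (hne : levelFn φ 0 y ∉ Ioo a b) :
    ∫ x in a..b, archKernel φ x y = archCopula φ b y - archCopula φ a y := by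
  refine intervalIntegral.integral_eq_sub_of_hasDeriv_right_of_le hab
    ((h.continuousOn_archCopula_left y).mono (Icc_subset_Icc ha hb)) (fun x hx => ?_)
    (h.intervalIntegrable_archKernel hy ⟨ha, hab.trans hb⟩ ⟨ha.trans hab, hb⟩)
  refine h.hasDerivWithinAt_archCopula ⟨ha.trans_lt hx.1, hx.2.trans_le hb⟩ hy ?_
  rintro rfl
  exact hne hx

/-- An Archimedean copula is recovered by integrating its Markov kernel. -/
lemma integral_archKernel (h : IsGenerator φ) {x y : ℝ} (hx : x ∈ Icc (0:ℝ) 1)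
    (hy : y ∈ Ioo (0:ℝ) 1) : ∫ s in 0..x, archKernel φ s y = archCopula φ x y := by
  have h0 : archCopula φ 0 y = 0 := h.archCopula_eq_zero le_self_add
  have hl0 : 0 ≤ levelFn φ 0 y := pseudoInv_nonneg _ _
  rcases le_or_gt x (levelFn φ 0 y) with hle | hlt
  · rw [h.integral_archKernel_eq_sub hy le_rfl hx.1 hx.2 (fun hm => hm.2.not_ge hle), h0, sub_zero]
  · have hl1 : levelFn φ 0 y ≤ 1 := pseudoInv_le_one _ _
    rw [← intervalIntegral.integral_add_adjacent_intervals
      (h.intervalIntegrable_archKernel hy ⟨le_rfl, zero_le_one⟩ ⟨hl0, hl1⟩)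
      (h.intervalIntegrable_archKernel hy ⟨hl0, hl1⟩ hx),
      h.integral_archKernel_eq_sub hy le_rfl hl0 hl1 (fun hm => lt_irrefl _ hm.2),
      h.integral_archKernel_eq_sub hy hl0 hlt.le hx.2 (fun hm => lt_irrefl _ hm.1), h0]
    ring

lemma ae_continuousAt_archKernel (h : IsGenerator φ) {y : ℝ} (hy : y ∈ Ioo (0:ℝ) 1) :
    ∀ᵐ x ∂(volume.restrict (Icc (0:ℝ) 1)), ContinuousAt (fun t => archKernel φ x t) y := by
  have hy' := Ioo_subset_Ioc_self hy
  have hcount : {x | x ∈ Ioo (0:ℝ) 1 ∧ φ x + φ y < φ 0 ∧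
      ¬ ContinuousAt (Dplus φ) (archCopula φ x y)}.Countable := by
    refine MapsTo.countable_of_injOn (f := fun x => archCopula φ x y)
      (t := {x | x ∈ Ioo (0:ℝ) 1 ∧ ¬ ContinuousAt (Dplus φ) x})
      (fun x hx => ⟨h.archCopula_mem hx.1 hx.2.1, hx.2.2⟩) (fun x hx z hz hxz => ?_)
      h.countable_not_continuousAt_Dplus
    have h1 := h.realGen_archCopula (Ioo_subset_Ioc_self hx.1) hy' hx.2.1.le
    have h2 := h.realGen_archCopula (Ioo_subset_Ioc_self hz.1) hy' hz.2.1.le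
    simp only at hxz
    rw [hxz, h2] at h1
    exact h.strictAntiOn_realGen.injOn (Ioo_subset_Ioc_self hx.1) (Ioo_subset_Ioc_self hz.1)
      (by linarith)
  filter_upwards [ae_mem_Ioo_ne (levelFn φ 0 y),
    hcount.ae_notMem (volume.restrict (Icc (0:ℝ) 1))] with x hx hx2
  have hx' := Ioo_subset_Ioc_self hx.1
  rcases lt_or_gt_of_ne hx.2 with hlt | hgt
  · rw [h.lt_levelFn_iff hy' hx', add_comm] at hlt
    have hev := ((tendsto_const_nhds (x := φ x)).add (h.continuousAt_apply hy)).eventually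
      (lt_mem_nhds hlt)
    refine (continuousAt_const (y := (0:ℝ))).congr ?_
    filter_upwards [hev, isOpen_Ioo.eventually_mem hy] with t ht1 ht2
    exact (h.archKernel_of_lt hx.1 (Ioo_subset_Ioc_self ht2) ht1).symm
  · have hpos := (h.levelFn_lt_iff hx').1 hgt
    have hD : ContinuousAt (Dplus φ) (archCopula φ x y) :=
      by_contra fun hc => hx2 ⟨hx.1, hpos, hc⟩
    have hC : ContinuousAt (archCopula φ x) y :=
      (h.continuousOn_archCopula_right x).continuousAt (Icc_mem_nhds hy.1 hy.2)
    have hK : ContinuousAt (fun t => Dplus φ x / Dplus φ (archCopula φ x t)) y :=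
      continuousAt_const.div (ContinuousAt.comp (f := archCopula φ x) hD hC)
        (h.Dplus_neg (h.archCopula_mem hx.1 hpos)).ne
    refine hK.congr ?_
    filter_upwards [h.eventually_add_lt hy hpos] with t ht
    exact (h.archKernel_of_le hx.1 (Ioo_subset_Ioc_self ht.1) ht.2.le).symm

lemma tendsto_archCopula_of_weakCondConv (h : IsGenerator φ) (hseq : ∀ n, IsGenerator (φseq n))
    (hw : WeakCondConv (fun n => archKernel (φseq n)) (archKernel φ))
    {x y : ℝ} (hx : x ∈ Icc (0:ℝ) 1) (hy : y ∈ Ioo (0:ℝ) 1) :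
    Tendsto (fun n => archCopula (φseq n) x y) atTop (nhds (archCopula φ x y)) := by
  simp only [← h.integral_archKernel hx hy, ← (hseq _).integral_archKernel hx hy]
  have hsub : uIoc 0 x ⊆ Icc (0:ℝ) 1 := by
    rw [uIoc_of_le hx.1]
    exact fun s hs => ⟨hs.1.le, hs.2.trans hx.2⟩
  refine intervalIntegral.tendsto_integral_filter_of_dominated_convergence (fun _ => 1)
    (Eventually.of_forall fun n => ((hseq n).aestronglyMeasurable_archKernel hy).mono_set hsub)
    (Eventually.of_forall fun n => ?_) intervalIntegrable_const ?_
  · filter_upwards [(ae_restrict_iff' measurableSet_Icc).1 ((hseq n).ae_norm_archKernel_le hy)]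
      with s hs hm using hs (hsub hm)
  · have hlim : ∀ᵐ s ∂(volume.restrict (Icc (0:ℝ) 1)),
        Tendsto (fun n => archKernel (φseq n) s y) atTop (nhds (archKernel φ s y)) := by
      filter_upwards [hw, h.ae_continuousAt_archKernel hy] with s hs hc
      exact hs y ⟨hy.1.le, hy.2.le⟩ hc.continuousWithinAt
    filter_upwards [(ae_restrict_iff' measurableSet_Icc).1 hlim] with s hs hm using hs (hsub hm)

/-- The generators `φseq n` are eventually on the same side of the level `d` as `φ`. -/
def SeparatesLevel (φ : ℝ → ℝ≥0∞) (φseq : ℕ → ℝ → ℝ≥0∞) (d : ℝ) : Prop :=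
  (∀ z ∈ Ioo (0:ℝ) 1, realGen φ z < d → ∀ᶠ n in atTop, realGen (φseq n) z < d) ∧
    ∀ z ∈ Ioo (0:ℝ) 1, d < realGen φ z → ∀ᶠ n in atTop, d < realGen (φseq n) z

lemma le_archCopula_iff (h : IsGenerator φ) {x y z : ℝ} (hx : x ∈ Ioc (0:ℝ) 1)
    (hy : y ∈ Ioc (0:ℝ) 1) (hz : z ∈ Ioc (0:ℝ) 1) :
    z ≤ archCopula φ x y ↔ realGen φ x + realGen φ y ≤ realGen φ z := by
  rw [archCopula, h.le_pseudoInv_iff hz, realGen, realGen, realGen,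
    ← ENNReal.toReal_add (h.finite x hx).ne (h.finite y hy).ne,
    ENNReal.toReal_le_toReal (ENNReal.add_ne_top.2 ⟨(h.finite x hx).ne, (h.finite y hy).ne⟩)
      (h.finite z hz).ne]

lemma eventually_add_le (h : IsGenerator φ) (hseq : ∀ n, IsGenerator (φseq n)) {x y z : ℝ}
    (hx : x ∈ Ioo (0:ℝ) 1) (hy : y ∈ Ioo (0:ℝ) 1) (hz : z ∈ Ioo (0:ℝ) 1)
    (hlim : Tendsto (fun n => archCopula (φseq n) x y) atTop (nhds (archCopula φ x y)))
    (hlt : realGen φ x + realGen φ y < realGen φ z) :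
    ∀ᶠ n in atTop, realGen (φseq n) x + realGen (φseq n) y ≤ realGen (φseq n) z := by
  have hx' := Ioo_subset_Ioc_self hx
  have hy' := Ioo_subset_Ioc_self hy
  have hz' := Ioo_subset_Ioc_self hz
  have hlt' : z < archCopula φ x y := by
    refine h.lt_pseudoInv ⟨hz.1.le, hz.2⟩ ?_
    rw [← ENNReal.toReal_lt_toReal (ENNReal.add_ne_top.2
      ⟨(h.finite x hx').ne, (h.finite y hy').ne⟩) (h.finite z hz').ne,
      ENNReal.toReal_add (h.finite x hx').ne (h.finite y hy').ne]
    exact hlt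
  filter_upwards [hlim.eventually (lt_mem_nhds hlt')] with n hn
  exact ((hseq n).le_archCopula_iff hx' hy' hz').1 hn.le

lemma eventually_lt_add (h : IsGenerator φ) (hseq : ∀ n, IsGenerator (φseq n)) {x y z : ℝ}
    (hx : x ∈ Ioo (0:ℝ) 1) (hy : y ∈ Ioo (0:ℝ) 1) (hz : z ∈ Ioo (0:ℝ) 1)
    (hlim : Tendsto (fun n => archCopula (φseq n) x y) atTop (nhds (archCopula φ x y)))
    (hlt : realGen φ z < realGen φ x + realGen φ y) :
    ∀ᶠ n in atTop, realGen (φseq n) z < realGen (φseq n) x + realGen (φseq n) y := by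
  have hx' := Ioo_subset_Ioc_self hx
  have hy' := Ioo_subset_Ioc_self hy
  have hz' := Ioo_subset_Ioc_self hz
  have hlt' : archCopula φ x y < z := by
    rwa [← not_le, h.le_archCopula_iff hx' hy' hz', not_le]
  filter_upwards [hlim.eventually (gt_mem_nhds hlt')] with n hn
  rwa [← not_le, (hseq n).le_archCopula_iff hx' hy' hz', not_le] at hn

lemma separatesLevel_one (h : IsGenerator φ) (hseq : ∀ n, IsGenerator (φseq n)) :
    SeparatesLevel φ φseq 1 := by
  have hhalf : (1/2 : ℝ) ∈ Ioc (0:ℝ) 1 := ⟨by norm_num, by norm_num⟩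
  refine ⟨fun z hz hlt => Eventually.of_forall fun n => ?_,
    fun z hz hlt => Eventually.of_forall fun n => ?_⟩
  · rw [← h.realGen_half, h.strictAntiOn_realGen.lt_iff_gt (Ioo_subset_Ioc_self hz) hhalf] at hlt
    rw [← (hseq n).realGen_half]
    exact (hseq n).strictAntiOn_realGen hhalf (Ioo_subset_Ioc_self hz) hlt
  · rw [← h.realGen_half, h.strictAntiOn_realGen.lt_iff_gt hhalf (Ioo_subset_Ioc_self hz)] at hlt
    rw [← (hseq n).realGen_half]
    exact (hseq n).strictAntiOn_realGen (Ioo_subset_Ioc_self hz) hhalf hlt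

lemma separatesLevel_half (h : IsGenerator φ) (hseq : ∀ n, IsGenerator (φseq n))
    (hlim : ∀ x ∈ Ioo (0:ℝ) 1, ∀ y ∈ Ioo (0:ℝ) 1,
      Tendsto (fun n => archCopula (φseq n) x y) atTop (nhds (archCopula φ x y)))
    {d : ℝ} (hd1 : d ≤ 1) (hd : SeparatesLevel φ φseq d) :
    SeparatesLevel φ φseq (d / 2) := by
  have hhalf : (1/2 : ℝ) ∈ Ioc (0:ℝ) 1 := ⟨by norm_num, by norm_num⟩
  have hquarter : (1/4 : ℝ) ∈ Ioc (0:ℝ) 1 := ⟨by norm_num, by norm_num⟩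
  have h4 : 1 < realGen φ (1/4) := by
    have := h.strictAntiOn_realGen hquarter hhalf (by norm_num)
    rwa [h.realGen_half] at this
  refine ⟨fun z hz hlt => ?_, fun z hz hlt => ?_⟩
  · obtain ⟨t, ht1, ht2⟩ := exists_between (show 2 * realGen φ z < d by linarith)
    obtain ⟨w, hw, hwt⟩ := h.exists_realGen_eq hquarter (t := t)
      ((mul_nonneg zero_le_two (realGen_nonneg z)).trans_lt ht1) (by linarith)
    filter_upwards [hd.1 w hw (by linarith),
      h.eventually_add_le hseq hz hz hw (hlim z hz z hz) (by linarith)] with n h1 h2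
    linarith
  · have hz0 : 0 < realGen φ z := by
      rw [← h.realGen_one]
      exact h.strictAntiOn_realGen (Ioo_subset_Ioc_self hz) ⟨zero_lt_one, le_rfl⟩ hz.2
    obtain ⟨t, ht1, ht2⟩ := exists_between
      (show max 0 d < min (2 * realGen φ z) (realGen φ (1/4)) from
        lt_min (max_lt (by linarith) (by linarith)) (max_lt (by linarith) (by linarith)))
    obtain ⟨w, hw, hwt⟩ := h.exists_realGen_eq hquarter (t := t)
      ((le_max_left _ _).trans_lt ht1) (ht2.le.trans (min_le_right _ _))
    have hdt := (le_max_right 0 d).trans_lt ht1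
    have htz := ht2.trans_le (min_le_left _ _)
    filter_upwards [hd.2 w hw (by linarith),
      h.eventually_lt_add hseq hz hz hw (hlim z hz z hz) (by linarith)] with n h1 h2
    linarith

lemma separatesLevel_add (h : IsGenerator φ) (hseq : ∀ n, IsGenerator (φseq n))
    (hlim : ∀ x ∈ Ioo (0:ℝ) 1, ∀ y ∈ Ioo (0:ℝ) 1,
      Tendsto (fun n => archCopula (φseq n) x y) atTop (nhds (archCopula φ x y)))
    {a b : ℝ} (ha0 : 0 < a) (hb0 : 0 < b) (ha : SeparatesLevel φ φseq a)
    (hb : SeparatesLevel φ φseq b) : SeparatesLevel φ φseq (a + b) := by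
  refine ⟨fun z hz hlt => ?_, fun z hz hlt => ?_⟩
  · have hz' := Ioo_subset_Ioc_self hz
    rcases lt_or_ge (realGen φ z) a with hza | hza
    · filter_upwards [ha.1 z hz hza] with n hn
      linarith
    rcases lt_or_ge (realGen φ z) b with hzb | hzb
    · filter_upwards [hb.1 z hz hzb] with n hn
      linarith
    obtain ⟨ε, hε0, hε⟩ := exists_between
      (show 0 < min (min a b) ((a + b - realGen φ z) / 2) from
        lt_min (lt_min ha0 hb0) (by linarith))
    obtain ⟨⟨hεa, hεb⟩, hεz⟩ : (ε < a ∧ ε < b) ∧ ε < (a + b - realGen φ z) / 2 := by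
      simpa only [lt_min_iff] using hε
    obtain ⟨u, hu, hua⟩ := h.exists_realGen_eq hz' (t := a - ε) (by linarith) (by linarith)
    obtain ⟨v, hv, hvb⟩ := h.exists_realGen_eq hz' (t := b - ε) (by linarith) (by linarith)
    filter_upwards [ha.1 u hu (by linarith), hb.1 v hv (by linarith),
      h.eventually_lt_add hseq hu hv hz (hlim u hu v hv) (by linarith)] with n h1 h2 h3
    linarith
  · have hz' := Ioo_subset_Ioc_self hz
    obtain ⟨ε, hε0, hε⟩ := exists_between
      (show 0 < (realGen φ z - (a + b)) / 2 by linarith)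
    obtain ⟨u, hu, hua⟩ := h.exists_realGen_eq hz' (t := a + ε) (by linarith) (by linarith)
    obtain ⟨v, hv, hvb⟩ := h.exists_realGen_eq hz' (t := b + ε) (by linarith) (by linarith)
    filter_upwards [ha.2 u hu (by linarith), hb.2 v hv (by linarith),
      h.eventually_add_le hseq hu hv hz (hlim u hu v hv) (by linarith)] with n h1 h2 h3
    linarith

lemma separatesLevel_dyadic (h : IsGenerator φ) (hseq : ∀ n, IsGenerator (φseq n))
    (hlim : ∀ x ∈ Ioo (0:ℝ) 1, ∀ y ∈ Ioo (0:ℝ) 1,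
      Tendsto (fun n => archCopula (φseq n) x y) atTop (nhds (archCopula φ x y)))
    (m k : ℕ) : SeparatesLevel φ φseq ((m + 1) * (1 / 2) ^ k) := by
  have hk : SeparatesLevel φ φseq ((1 / 2) ^ k) := by
    induction k with
    | zero => simpa using h.separatesLevel_one hseq
    | succ k ih =>
      have := h.separatesLevel_half hseq hlim (pow_le_one₀ (by norm_num) (by norm_num)) ih
      convert! this using 1
      ring
  induction m with
  | zero => simpa using hk
  | succ m ih =>
    have := h.separatesLevel_add hseq hlim (by positivity) (by positivity) ih hk
    convert! this using 1
    push_cast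
    ring

lemma exists_dyadic_between {a b : ℝ} (ha : 0 ≤ a) (hab : a < b) :
    ∃ m k : ℕ, a < (m + 1) * (1 / 2 : ℝ) ^ k ∧ (m + 1) * (1 / 2 : ℝ) ^ k < b := by
  obtain ⟨k, hk⟩ := exists_pow_lt_of_lt_one (sub_pos.2 hab) (show (1 / 2 : ℝ) < 1 by norm_num)
  have hp : (0:ℝ) < (1 / 2) ^ k := by positivity
  refine ⟨⌊a / (1 / 2) ^ k⌋₊, k, ?_, ?_⟩
  · exact (div_lt_iff₀ hp).1 (Nat.lt_floor_add_one _)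
  · have := (le_div_iff₀ hp).1 (Nat.floor_le (div_nonneg ha hp.le))
    linarith

theorem tendsto_of_weakCondConv (h : IsGenerator φ) (hseq : ∀ n, IsGenerator (φseq n))
    (hw : WeakCondConv (fun n => archKernel (φseq n)) (archKernel φ)) :
    ∀ x ∈ Ioc (0:ℝ) 1, Tendsto (fun n => φseq n x) atTop (nhds (φ x)) := by
  intro x hx
  rcases hx.2.eq_or_lt with rfl | hx1
  · simp only [h.map_one, (hseq _).map_one]
    exact tendsto_const_nhds
  have hlim : ∀ x ∈ Ioo (0:ℝ) 1, ∀ y ∈ Ioo (0:ℝ) 1,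
      Tendsto (fun n => archCopula (φseq n) x y) atTop (nhds (archCopula φ x y)) :=
    fun x hx y hy => h.tendsto_archCopula_of_weakCondConv hseq hw (Ioo_subset_Icc_self hx) hy
  have hreal : Tendsto (fun n => realGen (φseq n) x) atTop (nhds (realGen φ x)) := by
    refine tendsto_order.2 ⟨fun c hc => ?_, fun c hc => ?_⟩
    · rcases lt_or_ge c 0 with hc0 | hc0
      · exact Eventually.of_forall fun n => hc0.trans_le (realGen_nonneg x)
      obtain ⟨m, k, h1, h2⟩ := exists_dyadic_between hc0 hc
      filter_upwards [(h.separatesLevel_dyadic hseq hlim m k).2 x ⟨hx.1, hx1⟩ h2] with n hn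
      exact h1.trans hn
    · obtain ⟨m, k, h1, h2⟩ := exists_dyadic_between (realGen_nonneg x) hc
      filter_upwards [(h.separatesLevel_dyadic hseq hlim m k).1 x ⟨hx.1, hx1⟩ h1] with n hn
      exact hn.trans h2
  simpa only [h.ofReal_realGen hx, (hseq _).ofReal_realGen hx] using ENNReal.tendsto_ofReal hreal

end Convergence

end IsGenerator

/-- For Archimedean copulas, pointwise convergence of the generators on
`(0,1]` is equivalent to weak conditional convergence of the copulas. -/
theorem stmt11 (φ : ℝ → ℝ≥0∞) (φseq : ℕ → ℝ → ℝ≥0∞)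
    (hφ : IsGenerator φ) (hφseq : ∀ n, IsGenerator (φseq n)) :
    (∀ x ∈ Set.Ioc (0:ℝ) 1,
        Filter.Tendsto (fun n => φseq n x) Filter.atTop (nhds (φ x)))
      ↔ WeakCondConv (fun n => archKernel (φseq n)) (archKernel φ) := by
  exact ⟨hφ.weakCondConv_of_tendsto hφseq, hφ.tendsto_of_weakCondConv hφseq⟩
end
end

section
/- Let C, C₁, C₂, … be bivariate Extreme Value copulas with Pickands dependence functions A, A₁, A₂, …, respectively. Then the following are equivalent: (i) A_n(x) → A(x) for all x ∈ [0,1]; (ii) lim_{n→∞} D₁(C_n, C) = 0; (iii) (C_n) converges weakly conditional to C, i.e. for λ-almost every x ∈ [0,1] the probability measures K_{C_n}(x,·) converge weakly to K_C(x,·). -/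
open MeasureTheory Filter Set
open scoped ENNReal

noncomputable section

/-- `A` is a Pickands dependence function: convex on `[0,1]`, `A 0 = A 1 = 1` and
`max (1−x) x ≤ A x ≤ 1` on `[0,1]`. -/
def IsPickands (A : ℝ → ℝ) : Prop :=
  ConvexOn ℝ (Set.Icc (0:ℝ) 1) A ∧ A 0 = 1 ∧ A 1 = 1 ∧
    ∀ x ∈ Set.Icc (0:ℝ) 1, max (1 - x) x ≤ A x ∧ A x ≤ 1

/-- The Extreme Value copula induced by the Pickands dependence function `A`:
`C_A(x,y) = (xy)^{A(log x / log(xy))}` for `x,y ∈ (0,1)` and `C_A(x,y) = xy` otherwise. -/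
noncomputable def evCopula (A : ℝ → ℝ) (x y : ℝ) : ℝ :=
  if (0 < x ∧ x < 1) ∧ (0 < y ∧ y < 1) then
    (x * y) ^ A (Real.log x / Real.log (x * y))
  else x * y

/-- The set `Cont(D⁺A)` of continuity points of `D⁺A` in `(0,1)`. -/
def ContDA (A : ℝ → ℝ) : Set ℝ :=
  {x | x ∈ Set.Ioo (0:ℝ) 1 ∧ ContinuousAt (rightD A) x}

/-- The Markov kernel (as conditional distribution function `(x,y) ↦ K_{C_A}(x,[0,y])`) of
the Extreme Value copula induced by `A`. -/
noncomputable def evKernel (A : ℝ → ℝ) (x y : ℝ) : ℝ :=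
  if 0 < x ∧ x < 1 then
    if 0 < y ∧ y < 1 then
      evCopula A x y *
        (rightD A (Real.log x / Real.log (x * y)) * Real.log y / (x * Real.log (x * y))
          + A (Real.log x / Real.log (x * y)) / x)
    else y
  else 1

namespace IsPickands

variable {A : ℝ → ℝ}

lemma le_apply (hA : IsPickands A) {z : ℝ} (hz : z ∈ Icc (0:ℝ) 1) : z ≤ A z :=
  (le_max_right _ _).trans (hA.2.2.2 z hz).1

lemma one_sub_le_apply (hA : IsPickands A) {z : ℝ} (hz : z ∈ Icc (0:ℝ) 1) : 1 - z ≤ A z :=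
  (le_max_left _ _).trans (hA.2.2.2 z hz).1

lemma apply_le_one (hA : IsPickands A) {z : ℝ} (hz : z ∈ Icc (0:ℝ) 1) : A z ≤ 1 :=
  (hA.2.2.2 z hz).2

lemma continuousOn (hA : IsPickands A) : ContinuousOn A (Ioo (0:ℝ) 1) :=
  (hA.1.subset Ioo_subset_Icc_self (convex_Ioo 0 1)).continuousOn isOpen_Ioo

lemma continuousAt (hA : IsPickands A) {z : ℝ} (hz : z ∈ Ioo (0:ℝ) 1) : ContinuousAt A z :=
  hA.continuousOn.continuousAt (isOpen_Ioo.mem_nhds hz)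

/-- Backward difference quotients are dominated by the right-hand derivative. -/
lemma slope_le_rightD (hA : IsPickands A) {u z : ℝ} (hu : 0 ≤ u) (huz : u < z) (hz : z < 1) :
    (A z - A u) / (z - u) ≤ rightD A z := by
  refine le_csInf ((nonempty_Ioc.2 hz).image _) ?_
  rintro _ ⟨y, hy, rfl⟩
  exact hA.1.slope_mono_adjacent ⟨hu, by linarith⟩ ⟨by linarith [hy.1], hy.2⟩ huz hy.1

/-- Forward difference quotients dominate the right-hand derivative. -/
lemma rightD_le_slope (hA : IsPickands A) {z v : ℝ} (hz : 0 < z) (hzv : z < v) (hv : v ≤ 1) :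
    rightD A z ≤ (A v - A z) / (v - z) := by
  refine csInf_le ⟨(A z - A 0) / (z - 0), ?_⟩ ⟨v, ⟨hzv, hv⟩, rfl⟩
  rintro _ ⟨y, hy, rfl⟩
  exact hA.1.slope_mono_adjacent ⟨le_rfl, zero_le_one⟩ ⟨by linarith [hy.1], hy.2⟩ hz hy.1

lemma rightD_mono (hA : IsPickands A) {u v : ℝ} (hu : 0 < u) (huv : u < v) (hv : v < 1) :
    rightD A u ≤ rightD A v :=
  (hA.rightD_le_slope hu huv hv.le).trans (hA.slope_le_rightD hu.le huv hv)

lemma apply_add_mul_rightD_nonneg (hA : IsPickands A) {z : ℝ} (hz : z ∈ Ioo (0:ℝ) 1) :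
    0 ≤ A z + (1 - z) * rightD A z := by
  have h1 := hA.slope_le_rightD le_rfl hz.1 hz.2
  have h2 := hA.one_sub_le_apply (Ioo_subset_Icc_self hz)
  rw [hA.2.1, sub_zero, div_le_iff₀ hz.1] at h1
  have h3 := mul_le_mul_of_nonneg_left h1 (sub_nonneg.2 hz.2.le)
  have hz0 := hz.1
  by_contra! h
  nlinarith [mul_neg_of_pos_of_neg hz0 h]

lemma apply_add_mul_rightD_le_one (hA : IsPickands A) {z : ℝ} (hz : z ∈ Ioo (0:ℝ) 1) :
    A z + (1 - z) * rightD A z ≤ 1 := by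
  have h1 := hA.rightD_le_slope hz.1 hz.2 le_rfl
  rw [hA.2.2.1, le_div_iff₀ (sub_pos.2 hz.2)] at h1
  linarith

lemma neg_one_le_rightD (hA : IsPickands A) {z : ℝ} (hz : z ∈ Ioo (0:ℝ) 1) :
    -1 ≤ rightD A z := by
  refine le_trans ?_ (hA.slope_le_rightD le_rfl hz.1 hz.2)
  rw [hA.2.1, sub_zero, le_div_iff₀ hz.1]
  linarith [hA.one_sub_le_apply (Ioo_subset_Icc_self hz)]

lemma rightD_le_one (hA : IsPickands A) {z : ℝ} (hz : z ∈ Ioo (0:ℝ) 1) : rightD A z ≤ 1 := by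
  refine (hA.rightD_le_slope hz.1 hz.2 le_rfl).trans ?_
  rw [hA.2.2.1, div_le_iff₀ (sub_pos.2 hz.2)]
  linarith [hA.le_apply (Ioo_subset_Icc_self hz)]

lemma hasDerivAt (hA : IsPickands A) {z : ℝ} (hz : z ∈ Ioo (0:ℝ) 1)
    (hc : ContinuousAt (rightD A) z) : HasDerivAt A (rightD A z) z := by
  rw [hasDerivAt_iff_tendsto_slope, tendsto_iff_dist_tendsto_zero]
  have h0 : Tendsto (fun w => dist (rightD A w) (rightD A z)) (nhdsWithin z {z}ᶜ) (nhds 0) :=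
    tendsto_iff_dist_tendsto_zero.1 (hc.tendsto.mono_left nhdsWithin_le_nhds)
  refine squeeze_zero' (Eventually.of_forall fun _ => dist_nonneg) ?_ h0
  filter_upwards [nhdsWithin_le_nhds (isOpen_Ioo.mem_nhds hz), self_mem_nhdsWithin] with w hw hne
  rw [Real.dist_eq, Real.dist_eq, slope_def_field]
  rcases lt_or_gt_of_ne (show w ≠ z from hne) with h | h
  · have h1 := hA.rightD_le_slope hw.1 h hz.2.le
    have h2 := hA.slope_le_rightD hw.1.le h hz.2
    rw [← neg_div_neg_eq, neg_sub, neg_sub]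
    rw [abs_of_nonpos (by linarith), abs_of_nonpos (by linarith)]
    linarith
  · have h1 := hA.rightD_le_slope hz.1 h hw.2.le
    have h2 := hA.slope_le_rightD hz.1.le h hw.2
    rw [abs_of_nonneg (by linarith), abs_of_nonneg (by linarith)]
    linarith

end IsPickands

/-- The right-hand derivative extended monotonically from `(0,1)` to the real line. -/
def rightDExt (A : ℝ → ℝ) (z : ℝ) : ℝ :=
  if z ≤ 0 then -1 else if z < 1 then rightD A z else 1

lemma rightDExt_eq {A : ℝ → ℝ} {z : ℝ} (hz : z ∈ Ioo (0:ℝ) 1) : rightDExt A z = rightD A z := by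
  simp [rightDExt, hz.1.not_ge, hz.2]

lemma continuousAt_rightDExt_iff {A : ℝ → ℝ} {z : ℝ} (hz : z ∈ Ioo (0:ℝ) 1) :
    ContinuousAt (rightDExt A) z ↔ ContinuousAt (rightD A) z :=
  continuousAt_congr (eventually_of_mem (isOpen_Ioo.mem_nhds hz) fun _ h => rightDExt_eq h)

lemma IsPickands.monotone_rightDExt {A : ℝ → ℝ} (hA : IsPickands A) :
    Monotone (rightDExt A) := by
  intro u v huv
  rcases huv.eq_or_lt with rfl | huv
  · rfl
  simp only [rightDExt]
  split_ifs with h1 h2 h3 h4 h5 h6 <;> try linarith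
  · exact hA.neg_one_le_rightD ⟨by linarith, by linarith⟩
  · exact hA.rightD_mono (by linarith) huv (by linarith)
  · exact hA.rightD_le_one ⟨by linarith, by linarith⟩

lemma IsPickands.countable_not_continuousAt_rightD {A : ℝ → ℝ} (hA : IsPickands A) :
    {z | z ∈ Ioo (0:ℝ) 1 ∧ ¬ ContinuousAt (rightD A) z}.Countable :=
  hA.monotone_rightDExt.countable_not_continuousAt.mono fun _ hz h =>
    hz.2 ((continuousAt_rightDExt_iff hz.1).1 h)

/-- Pointwise convergence of Pickands functions forces convergence of the right-hand derivatives
at every point where the limiting one is approximated from the left. -/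
lemma tendsto_rightD {A : ℝ → ℝ} {Aseq : ℕ → ℝ → ℝ}
    (hA : IsPickands A) (hAseq : ∀ n, IsPickands (Aseq n))
    (hlim : ∀ x ∈ Icc (0:ℝ) 1, Tendsto (fun n => Aseq n x) atTop (nhds (A x)))
    {z : ℝ} (hz : z ∈ Ioo (0:ℝ) 1)
    (hc : ∀ ε > 0, ∃ u ∈ Ioo (0:ℝ) z, rightD A z - ε < rightD A u) :
    Tendsto (fun n => rightD (Aseq n) z) atTop (nhds (rightD A z)) := by
  have hslope : ∀ u ∈ Icc (0:ℝ) 1, ∀ v ∈ Icc (0:ℝ) 1,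
      Tendsto (fun n => (Aseq n v - Aseq n u) / (v - u)) atTop (nhds ((A v - A u) / (v - u))) :=
    fun u hu v hv => ((hlim v hv).sub (hlim u hu)).div_const _
  have hz' := Ioo_subset_Icc_self hz
  refine tendsto_order.2 ⟨fun a ha => ?_, fun a ha => ?_⟩
  · obtain ⟨u, hu, hau⟩ := hc _ (sub_pos.2 ha)
    have hlt : a < (A z - A u) / (z - u) :=
      lt_of_lt_of_le (by linarith) (hA.rightD_le_slope hu.1 hu.2 hz.2.le)
    filter_upwards [(hslope u ⟨hu.1.le, by linarith [hu.2, hz.2]⟩ z hz').eventually_const_lt hlt]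
      with n hn
    exact hn.trans_le ((hAseq n).slope_le_rightD hu.1.le hu.2 hz.2)
  · obtain ⟨_, ⟨v, hv, rfl⟩, hva⟩ := exists_lt_of_csInf_lt ((nonempty_Ioc.2 hz.2).image _) ha
    filter_upwards [(hslope z hz' v ⟨by linarith [hz.1, hv.1], hv.2⟩).eventually_lt_const hva]
      with n hn
    exact ((hAseq n).rightD_le_slope hz.1 hv.1 hv.2).trans_lt hn

/-- The argument `log x / log (xy)` at which the Pickands function is evaluated. -/
def pickandsArg (x y : ℝ) : ℝ := Real.log x / Real.log (x * y)

lemma log_mul_of_mem {x y : ℝ} (hx : x ∈ Ioo (0:ℝ) 1) (hy : y ∈ Ioo (0:ℝ) 1) :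
    Real.log (x * y) = Real.log x + Real.log y :=
  Real.log_mul hx.1.ne' hy.1.ne'

lemma log_mul_neg_of_mem {x y : ℝ} (hx : x ∈ Ioo (0:ℝ) 1) (hy : y ∈ Ioo (0:ℝ) 1) :
    Real.log (x * y) < 0 := by
  rw [log_mul_of_mem hx hy]
  linarith [Real.log_neg hx.1 hx.2, Real.log_neg hy.1 hy.2]

lemma one_sub_pickandsArg {x y : ℝ} (hx : x ∈ Ioo (0:ℝ) 1) (hy : y ∈ Ioo (0:ℝ) 1) :
    1 - pickandsArg x y = Real.log y / Real.log (x * y) := by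
  have h := (log_mul_neg_of_mem hx hy).ne
  rw [pickandsArg, eq_div_iff h, sub_mul, div_mul_cancel₀ _ h, log_mul_of_mem hx hy]
  ring

lemma pickandsArg_mem {x y : ℝ} (hx : x ∈ Ioo (0:ℝ) 1) (hy : y ∈ Ioo (0:ℝ) 1) :
    pickandsArg x y ∈ Ioo (0:ℝ) 1 := by
  have h := log_mul_neg_of_mem hx hy
  refine ⟨div_pos_of_neg_of_neg (Real.log_neg hx.1 hx.2) h, sub_pos.1 ?_⟩
  rw [one_sub_pickandsArg hx hy]
  exact div_pos_of_neg_of_neg (Real.log_neg hy.1 hy.2) h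

lemma pickandsArg_strictMonoOn {x : ℝ} (hx : x ∈ Ioo (0:ℝ) 1) :
    StrictMonoOn (pickandsArg x) (Ioo 0 1) := by
  intro s hs t ht hst
  have h1 := log_mul_neg_of_mem hx hs
  have h2 := log_mul_neg_of_mem hx ht
  have h3 := Real.log_lt_log hs.1 hst
  have h4 := Real.log_neg hx.1 hx.2
  rw [pickandsArg, pickandsArg, ← neg_div_neg_eq, ← neg_div_neg_eq (Real.log x),
    div_lt_div_iff₀ (by linarith) (by linarith), log_mul_of_mem hx hs, log_mul_of_mem hx ht]
  nlinarith

lemma pickandsArg_strictAntiOn {y : ℝ} (hy : y ∈ Ioo (0:ℝ) 1) :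
    StrictAntiOn (fun x => pickandsArg x y) (Ioo 0 1) := by
  intro s hs t ht hst
  have h := pickandsArg_strictMonoOn hy hs ht hst
  have hs' := one_sub_pickandsArg hs hy
  have ht' := one_sub_pickandsArg ht hy
  rw [pickandsArg, pickandsArg, mul_comm y s, mul_comm y t, log_mul_of_mem hs hy,
    log_mul_of_mem ht hy] at h
  have h1 := log_mul_neg_of_mem hs hy
  have h2 := log_mul_neg_of_mem ht hy
  rw [log_mul_of_mem hs hy] at hs' h1
  rw [log_mul_of_mem ht hy] at ht' h2
  show pickandsArg t y < pickandsArg s y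
  linarith

lemma hasDerivAt_pickandsArg {x y : ℝ} (hx : x ∈ Ioo (0:ℝ) 1) (hy : y ∈ Ioo (0:ℝ) 1) :
    HasDerivAt (fun t => pickandsArg t y) (Real.log y / (x * Real.log (x * y) ^ 2)) x := by
  have hx0 := hx.1.ne'
  have hy0 := hy.1.ne'
  have h := (log_mul_neg_of_mem hx hy).ne
  have h1 := (Real.hasDerivAt_log hx0).div (((hasDerivAt_id x).mul_const y).log
    (mul_ne_zero hx0 hy0)) h
  refine h1.congr_deriv ?_
  have hl := log_mul_of_mem hx hy
  simp only [id]
  field_simp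
  rw [hl]
  ring

lemma continuousAt_pickandsArg_right {x y : ℝ} (hx : x ∈ Ioo (0:ℝ) 1) (hy : y ∈ Ioo (0:ℝ) 1) :
    ContinuousAt (pickandsArg x) y :=
  continuousAt_const.div ((continuousAt_const.mul continuousAt_id).log
    (mul_ne_zero hx.1.ne' hy.1.ne')) (log_mul_neg_of_mem hx hy).ne

lemma evCopula_of_mem (A : ℝ → ℝ) {x y : ℝ} (hx : x ∈ Ioo (0:ℝ) 1) (hy : y ∈ Ioo (0:ℝ) 1) :
    evCopula A x y = Real.exp (Real.log (x * y) * A (pickandsArg x y)) := by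
  rw [evCopula, if_pos ⟨hx, hy⟩, Real.rpow_def_of_pos (mul_pos hx.1 hy.1)]
  rfl

lemma evKernel_of_notMem_left (A : ℝ → ℝ) {x : ℝ} (hx : x ∉ Ioo (0:ℝ) 1) (y : ℝ) :
    evKernel A x y = 1 :=
  if_neg hx

lemma evKernel_of_notMem_right (A : ℝ → ℝ) {x y : ℝ} (hx : x ∈ Ioo (0:ℝ) 1)
    (hy : y ∉ Ioo (0:ℝ) 1) : evKernel A x y = y :=
  (if_pos hx).trans (if_neg hy)

lemma evKernel_of_mem (A : ℝ → ℝ) {x y : ℝ} (hx : x ∈ Ioo (0:ℝ) 1) (hy : y ∈ Ioo (0:ℝ) 1) :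
    evKernel A x y = evCopula A x y / x *
      (A (pickandsArg x y) + (1 - pickandsArg x y) * rightD A (pickandsArg x y)) := by
  have h0 : evKernel A x y = evCopula A x y * (rightD A (pickandsArg x y) * Real.log y /
      (x * Real.log (x * y)) + A (pickandsArg x y) / x) :=
    (if_pos (show 0 < x ∧ x < 1 from hx)).trans (if_pos hy)
  rw [h0, one_sub_pickandsArg hx hy]
  have hx0 := hx.1.ne'
  have h := (log_mul_neg_of_mem hx hy).ne
  field_simp
  ring

lemma evCopula_pos (A : ℝ → ℝ) {x y : ℝ} (hx : x ∈ Ioo (0:ℝ) 1) (hy : y ∈ Ioo (0:ℝ) 1) :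
    0 < evCopula A x y := by
  rw [evCopula_of_mem A hx hy]
  exact Real.exp_pos _

lemma evCopula_le_left {A : ℝ → ℝ} (hA : IsPickands A) {x y : ℝ} (hx : x ∈ Ioo (0:ℝ) 1)
    (hy : y ∈ Ioo (0:ℝ) 1) : evCopula A x y ≤ x := by
  have h := log_mul_neg_of_mem hx hy
  rw [evCopula_of_mem A hx hy]
  conv_rhs => rw [← Real.exp_log hx.1]
  have hx' : Real.log x = Real.log (x * y) * pickandsArg x y :=
    (mul_div_cancel₀ _ h.ne).symm
  rw [Real.exp_le_exp, hx']
  exact mul_le_mul_of_nonpos_left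
    (hA.le_apply (Ioo_subset_Icc_self (pickandsArg_mem hx hy))) h.le

lemma evKernel_mem_Icc {A : ℝ → ℝ} (hA : IsPickands A) (x : ℝ) {y : ℝ} (hy : y ∈ Icc (0:ℝ) 1) :
    evKernel A x y ∈ Icc (0:ℝ) 1 := by
  by_cases hx : x ∈ Ioo (0:ℝ) 1
  · by_cases hy' : y ∈ Ioo (0:ℝ) 1
    · have hz := pickandsArg_mem hx hy'
      rw [evKernel_of_mem A hx hy']
      have h1 := (evCopula_pos A hx hy').le
      have h2 : evCopula A x y / x ≤ 1 := (div_le_one hx.1).2 (evCopula_le_left hA hx hy')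
      have h3 := hA.apply_add_mul_rightD_nonneg hz
      exact ⟨mul_nonneg (div_nonneg h1 hx.1.le) h3,
        mul_le_one₀ h2 h3 (hA.apply_add_mul_rightD_le_one hz)⟩
    · rw [evKernel_of_notMem_right A hx hy']
      exact hy
  · rw [evKernel_of_notMem_left A hx]
    simp

lemma measurable_evKernel {A : ℝ → ℝ} (hA : IsPickands A) :
    Measurable fun p : ℝ × ℝ => evKernel A p.1 p.2 := by
  classical
  have hAm : Measurable ((Ioo (0:ℝ) 1).piecewise A fun _ => 0) :=
    hA.continuousOn.measurable_piecewise continuousOn_const measurableSet_Ioo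
  have hDm : Measurable (rightDExt A) := hA.monotone_rightDExt.measurable
  have hz : Measurable fun p : ℝ × ℝ => pickandsArg p.1 p.2 := by
    unfold pickandsArg
    fun_prop
  have hxs : MeasurableSet {p : ℝ × ℝ | p.1 ∈ Ioo (0:ℝ) 1} := measurable_fst measurableSet_Ioo
  have hys : MeasurableSet {p : ℝ × ℝ | p.2 ∈ Ioo (0:ℝ) 1} := measurable_snd measurableSet_Ioo
  have hAz := hAm.comp hz
  have hDz := hDm.comp hz
  have hg : Measurable fun p : ℝ × ℝ => if p.1 ∈ Ioo (0:ℝ) 1 then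
      if p.2 ∈ Ioo (0:ℝ) 1 then
        Real.exp (Real.log (p.1 * p.2) * (Ioo (0:ℝ) 1).piecewise A (fun _ => 0)
          (pickandsArg p.1 p.2)) / p.1 *
          ((Ioo (0:ℝ) 1).piecewise A (fun _ => 0) (pickandsArg p.1 p.2) +
            (1 - pickandsArg p.1 p.2) * rightDExt A (pickandsArg p.1 p.2))
      else p.2
      else 1 := by
    refine Measurable.ite hxs (Measurable.ite hys ?_ measurable_snd) measurable_const
    refine Measurable.mul (Measurable.div (Measurable.exp (Measurable.mul ?_ hAz))
      measurable_fst) (hAz.add (Measurable.mul (measurable_const.sub hz) hDz))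
    fun_prop
  convert hg using 2 with p
  split_ifs with hx hy
  · have hp := pickandsArg_mem hx hy
    rw [evKernel_of_mem A hx hy, evCopula_of_mem A hx hy, rightDExt_eq hp,
      piecewise_eq_of_mem _ _ _ hp]
  · exact evKernel_of_notMem_right A hx hy
  · exact evKernel_of_notMem_left A hx _

lemma continuousAt_evCopula_right {A : ℝ → ℝ} (hA : IsPickands A) {x y : ℝ}
    (hx : x ∈ Ioo (0:ℝ) 1) (hy : y ∈ Ioo (0:ℝ) 1) : ContinuousAt (evCopula A x) y := by
  have hl : ContinuousAt (fun t => Real.log (x * t)) y :=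
    (continuousAt_const.mul continuousAt_id).log (mul_ne_zero hx.1.ne' hy.1.ne')
  have hAz : ContinuousAt (fun t => A (pickandsArg x t)) y :=
    ContinuousAt.comp (g := A) (hA.continuousAt (pickandsArg_mem hx hy))
      (continuousAt_pickandsArg_right hx hy)
  refine (continuousAt_congr ?_).2 (hl.mul hAz).rexp
  exact eventually_of_mem (isOpen_Ioo.mem_nhds hy) fun t ht => evCopula_of_mem A hx ht

lemma continuousAt_evKernel_right {A : ℝ → ℝ} (hA : IsPickands A) {x y : ℝ}
    (hx : x ∈ Ioo (0:ℝ) 1) (hy : y ∈ Ioo (0:ℝ) 1)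
    (hc : ContinuousAt (rightD A) (pickandsArg x y)) : ContinuousAt (evKernel A x) y := by
  have hz := continuousAt_pickandsArg_right hx hy
  have hAz : ContinuousAt (fun t => A (pickandsArg x t)) y :=
    ContinuousAt.comp (g := A) (hA.continuousAt (pickandsArg_mem hx hy)) hz
  have hDz : ContinuousAt (fun t => rightD A (pickandsArg x t)) y :=
    ContinuousAt.comp (g := rightD A) hc hz
  refine (continuousAt_congr ?_).2 (((continuousAt_evCopula_right hA hx hy).div_const x).mul
    (hAz.add ((continuousAt_const (y := (1:ℝ)).sub hz).mul hDz)))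
  exact eventually_of_mem (isOpen_Ioo.mem_nhds hy) fun t ht => evKernel_of_mem A hx ht

lemma continuousAt_rightD_comp_pickandsArg {A : ℝ → ℝ} (hA : IsPickands A) {x y : ℝ}
    (hx : x ∈ Ioo (0:ℝ) 1) (hy : y ∈ Ioo (0:ℝ) 1) (hc : ContinuousAt (evKernel A x) y) :
    ContinuousAt (fun t => rightD A (pickandsArg x t)) y := by
  have hz := continuousAt_pickandsArg_right hx hy
  have hzm := pickandsArg_mem hx hy
  have hAz : ContinuousAt (fun t => A (pickandsArg x t)) y :=
    ContinuousAt.comp (g := A) (hA.continuousAt hzm) hz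
  have hC := (continuousAt_evCopula_right hA hx hy).div_const x
  have hC0 : evCopula A x y / x ≠ 0 := (div_pos (evCopula_pos A hx hy) hx.1).ne'
  refine (continuousAt_congr ?_).2 (((hc.div hC hC0).sub hAz).div
    (continuousAt_const.sub hz) (sub_pos.2 hzm.2).ne')
  refine eventually_of_mem (isOpen_Ioo.mem_nhds hy) fun t ht => ?_
  have h1 : evCopula A x t / x ≠ 0 := (div_pos (evCopula_pos A hx ht) hx.1).ne'
  have h2 : 1 - pickandsArg x t ≠ 0 := (sub_pos.2 (pickandsArg_mem hx ht).2).ne'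
  change rightD A (pickandsArg x t) =
    (evKernel A x t / (evCopula A x t / x) - A (pickandsArg x t)) / (1 - pickandsArg x t)
  rw [evKernel_of_mem A hx ht, mul_div_cancel_left₀ _ h1, add_sub_cancel_left,
    mul_div_cancel_left₀ _ h2]

lemma weakCondConv_of_tendsto {A : ℝ → ℝ} {Aseq : ℕ → ℝ → ℝ}
    (hA : IsPickands A) (hAseq : ∀ n, IsPickands (Aseq n))
    (hlim : ∀ x ∈ Icc (0:ℝ) 1, Tendsto (fun n => Aseq n x) atTop (nhds (A x))) :
    WeakCondConv (fun n => evKernel (Aseq n)) (evKernel A) := by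
  refine Eventually.of_forall fun x y hyI hc => ?_
  by_cases hx : x ∈ Ioo (0:ℝ) 1
  swap
  · simp only [evKernel_of_notMem_left _ hx]
    exact tendsto_const_nhds
  by_cases hy : y ∈ Ioo (0:ℝ) 1
  swap
  · simp only [evKernel_of_notMem_right _ hx hy]
    exact tendsto_const_nhds
  have hz := pickandsArg_mem hx hy
  have hD := continuousAt_rightD_comp_pickandsArg hA hx hy
    (hc.continuousAt (Icc_mem_nhds hy.1 hy.2))
  have hDlim : Tendsto (fun n => rightD (Aseq n) (pickandsArg x y)) atTop
      (nhds (rightD A (pickandsArg x y))) := by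
    refine tendsto_rightD hA hAseq hlim hz fun ε hε => ?_
    have hev : ∀ᶠ t in nhdsWithin y (Iio y), rightD A (pickandsArg x y) - ε <
        rightD A (pickandsArg x t) ∧ t ∈ Ioo (0:ℝ) 1 ∧ t < y := by
      filter_upwards [nhdsWithin_le_nhds (hD.eventually_const_lt (sub_lt_self _ hε)),
        nhdsWithin_le_nhds (isOpen_Ioo.mem_nhds hy), self_mem_nhdsWithin] with t h1 h2 h3
      exact ⟨h1, h2, h3⟩
    obtain ⟨t, h1, h2, h3⟩ := hev.exists
    exact ⟨_, ⟨(pickandsArg_mem hx h2).1, pickandsArg_strictMonoOn hx h2 hy h3⟩, h1⟩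
  have hAlim := hlim _ (Ioo_subset_Icc_self hz)
  simp only [evKernel_of_mem _ hx hy, evCopula_of_mem _ hx hy]
  exact (((hAlim.const_mul _).rexp).div_const x).mul (hAlim.add (hDlim.const_mul _))

lemma countable_not_continuousAt_evKernel {A : ℝ → ℝ} (hA : IsPickands A) {x : ℝ}
    (hx : x ∈ Ioo (0:ℝ) 1) :
    {y | y ∈ Ioo (0:ℝ) 1 ∧ ¬ ContinuousAt (evKernel A x) y}.Countable := by
  refine MapsTo.countable_of_injOn (f := pickandsArg x) ?_
    ((pickandsArg_strictMonoOn hx).injOn.mono fun _ h => h.1) hA.countable_not_continuousAt_rightD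
  exact fun y hy => ⟨pickandsArg_mem hx hy.1,
    fun h => hy.2 (continuousAt_evKernel_right hA hx hy.1 h)⟩

lemma abs_evKernel_sub_le {A B : ℝ → ℝ} (hA : IsPickands A) (hB : IsPickands B) (x : ℝ) {y : ℝ}
    (hy : y ∈ Icc (0:ℝ) 1) : |evKernel A x y - evKernel B x y| ≤ 1 := by
  have h1 := evKernel_mem_Icc hA x hy
  have h2 := evKernel_mem_Icc hB x hy
  exact abs_sub_le_iff.2 ⟨by linarith [h1.2, h2.1], by linarith [h1.1, h2.2]⟩

lemma measurable_abs_evKernel_sub {A B : ℝ → ℝ} (hA : IsPickands A) (hB : IsPickands B) :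
    Measurable fun p : ℝ × ℝ => |evKernel A p.1 p.2 - evKernel B p.1 p.2| :=
  continuous_abs.measurable.comp ((measurable_evKernel hA).sub (measurable_evKernel hB))

lemma integrable_abs_evKernel_sub {A B : ℝ → ℝ} (hA : IsPickands A) (hB : IsPickands B) :
    Integrable (fun p : ℝ × ℝ => |evKernel A p.1 p.2 - evKernel B p.1 p.2|)
      ((volume.restrict (Icc (0:ℝ) 1)).prod (volume.restrict (Icc (0:ℝ) 1))) := by
  refine Integrable.of_bound (measurable_abs_evKernel_sub hA hB).aestronglyMeasurable 1 ?_
  rw [Measure.prod_restrict]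
  refine ae_restrict_of_forall_mem (measurableSet_Icc.prod measurableSet_Icc) fun p hp => ?_
  rw [Real.norm_eq_abs, abs_abs]
  exact abs_evKernel_sub_le hA hB _ hp.2

lemma integral_Icc_one_mem {f : ℝ → ℝ} (h0 : ∀ y, 0 ≤ f y) (h1 : ∀ y ∈ Icc (0:ℝ) 1, f y ≤ 1) :
    ‖∫ y in Icc (0:ℝ) 1, f y‖ ≤ 1 := by
  have h := norm_setIntegral_le_of_norm_le_const (μ := volume) (s := Icc (0:ℝ) 1) (f := f) (C := 1)
    (by simp) fun y hy => by rw [Real.norm_of_nonneg (h0 y)]; exact h1 y hy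
  simpa using h

lemma tendsto_D1_of_weakCondConv {A : ℝ → ℝ} {Aseq : ℕ → ℝ → ℝ}
    (hA : IsPickands A) (hAseq : ∀ n, IsPickands (Aseq n))
    (h : WeakCondConv (fun n => evKernel (Aseq n)) (evKernel A)) :
    Tendsto (fun n => D1 (evKernel (Aseq n)) (evKernel A)) atTop (nhds 0) := by
  have hswap : ∀ n, D1 (evKernel (Aseq n)) (evKernel A) = ∫ x in Icc (0:ℝ) 1,
      ∫ y in Icc (0:ℝ) 1, |evKernel (Aseq n) x y - evKernel A x y| := fun n =>
    (integral_integral_swap (f := fun x y => |evKernel (Aseq n) x y - evKernel A x y|)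
      (integrable_abs_evKernel_sub (hAseq n) hA)).symm
  simp only [hswap]
  have hIoo : ∀ᵐ x ∂(volume.restrict (Icc (0:ℝ) 1)), x ∈ Ioo (0:ℝ) 1 := by
    rw [← restrict_Ioo_eq_restrict_Icc]
    exact ae_restrict_mem measurableSet_Ioo
  have key := tendsto_integral_of_dominated_convergence (μ := volume.restrict (Icc (0:ℝ) 1))
    (F := fun n x => ∫ y in Icc (0:ℝ) 1, |evKernel (Aseq n) x y - evKernel A x y|)
    (f := fun _ => 0) (fun _ => 1) ?_ (integrable_const _) ?_ ?_
  · simpa using key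
  · exact fun n => (integrable_abs_evKernel_sub (hAseq n) hA).aestronglyMeasurable.integral_prod_right'
  · exact fun n => Eventually.of_forall fun x => integral_Icc_one_mem (fun _ => abs_nonneg _)
      fun y hy => abs_evKernel_sub_le (hAseq n) hA x hy
  filter_upwards [h, hIoo] with x hx hx01
  have key' := tendsto_integral_of_dominated_convergence (μ := volume.restrict (Icc (0:ℝ) 1))
    (F := fun n y => |evKernel (Aseq n) x y - evKernel A x y|)
    (f := fun _ => 0) (fun _ => 1) ?_ (integrable_const _) ?_ ?_
  · simpa using key'
  · exact fun n => ((measurable_abs_evKernel_sub (hAseq n) hA).comp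
      measurable_prodMk_left).aestronglyMeasurable
  · refine fun n => ae_restrict_of_forall_mem measurableSet_Icc fun y hy => ?_
    rw [Real.norm_eq_abs, abs_abs]
    exact abs_evKernel_sub_le (hAseq n) hA x hy
  · have hc : ∀ᵐ y ∂(volume.restrict (Icc (0:ℝ) 1)),
        y ∉ {y | y ∈ Ioo (0:ℝ) 1 ∧ ¬ ContinuousAt (evKernel A x) y} :=
      ae_restrict_of_ae ((countable_not_continuousAt_evKernel hA hx01).ae_notMem _)
    filter_upwards [hIoo, hc] with y hy hyc
    have hcont : ContinuousAt (evKernel A x) y := by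
      by_contra hn
      exact hyc ⟨hy, hn⟩
    have ht := hx y (Ioo_subset_Icc_self hy) hcont.continuousWithinAt
    simpa using (ht.sub_const (evKernel A x y)).abs

lemma hasDerivAt_evCopula_left {A : ℝ → ℝ} (hA : IsPickands A) {x y : ℝ}
    (hx : x ∈ Ioo (0:ℝ) 1) (hy : y ∈ Ioo (0:ℝ) 1)
    (hc : ContinuousAt (rightD A) (pickandsArg x y)) :
    HasDerivAt (fun t => evCopula A t y) (evKernel A x y) x := by
  have hx0 := hx.1.ne'
  have hl := (log_mul_neg_of_mem hx hy).ne
  have h1 : HasDerivAt (fun t => A (pickandsArg t y)) _ x :=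
    HasDerivAt.comp (h₂ := A) x (hA.hasDerivAt (pickandsArg_mem hx hy) hc)
      (hasDerivAt_pickandsArg hx hy)
  have h2 : HasDerivAt (fun t => Real.log (t * y)) _ x :=
    ((hasDerivAt_id x).mul_const y).log (mul_ne_zero hx0 hy.1.ne')
  have heq : (fun t => evCopula A t y) =ᶠ[nhds x]
      fun t => Real.exp (Real.log (t * y) * A (pickandsArg t y)) :=
    eventually_of_mem (isOpen_Ioo.mem_nhds hx) fun t ht => evCopula_of_mem A ht hy
  refine ((h2.mul h1).exp.congr_of_eventuallyEq heq).congr_deriv ?_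
  have hy0 := hy.1.ne'
  rw [evKernel_of_mem A hx hy, evCopula_of_mem A hx hy, one_sub_pickandsArg hx hy]
  simp only [id, Pi.mul_apply]
  field_simp

lemma integral_evKernel_left {A : ℝ → ℝ} (hA : IsPickands A) {a b y : ℝ} (ha : 0 < a)
    (hab : a ≤ b) (hb : b < 1) (hy : y ∈ Ioo (0:ℝ) 1) :
    IntervalIntegrable (fun x => evKernel A x y) volume a b ∧
      ∫ x in a..b, evKernel A x y = evCopula A b y - evCopula A a y := by
  have hsub : Icc a b ⊆ Ioo 0 1 := fun x hx => ⟨ha.trans_le hx.1, hx.2.trans_lt hb⟩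
  have hint : IntervalIntegrable (fun x => evKernel A x y) volume a b := by
    refine (intervalIntegrable_const (c := (1:ℝ))).mono_fun
      ((measurable_evKernel hA).comp measurable_prodMk_right).aestronglyMeasurable
      (Eventually.of_forall fun x => ?_)
    have h := evKernel_mem_Icc hA x (Ioo_subset_Icc_self hy)
    beta_reduce
    rw [Real.norm_of_nonneg h.1, norm_one]
    exact h.2
  refine ⟨hint, ?_⟩
  refine integral_eq_of_hasDerivAt_off_countable_of_le (fun x => evCopula A x y) _ hab
    (s := {x | x ∈ Ioo (0:ℝ) 1 ∧ ¬ ContinuousAt (rightD A) (pickandsArg x y)}) ?_ ?_ ?_ hint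
  · refine MapsTo.countable_of_injOn (f := fun x => pickandsArg x y) ?_
      ((pickandsArg_strictAntiOn hy).injOn.mono fun _ h => h.1)
      hA.countable_not_continuousAt_rightD
    exact fun x hx => ⟨pickandsArg_mem hx.1 hy, hx.2⟩
  · intro x hx
    have hx := hsub hx
    have hl : ContinuousAt (fun t => Real.log (t * y)) x :=
      (continuousAt_id.mul continuousAt_const).log (mul_ne_zero hx.1.ne' hy.1.ne')
    have hAz : ContinuousAt (fun t => A (pickandsArg t y)) x :=
      ContinuousAt.comp (g := A) (hA.continuousAt (pickandsArg_mem hx hy))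
        (hasDerivAt_pickandsArg hx hy).continuousAt
    refine ((continuousAt_congr ?_).2 (hl.mul hAz).rexp).continuousWithinAt
    exact eventually_of_mem (isOpen_Ioo.mem_nhds hx) fun t ht => evCopula_of_mem A ht hy
  · rintro x ⟨hx, hxs⟩
    have hx := hsub (Ioo_subset_Icc_self hx)
    refine hasDerivAt_evCopula_left hA hx hy ?_
    by_contra hn
    exact hxs ⟨hx, hn⟩

lemma abs_evCopula_sub_le_integral {A B : ℝ → ℝ} (hA : IsPickands A) (hB : IsPickands B)
    {b y : ℝ} (hb : b ∈ Ioo (0:ℝ) 1) (hy : y ∈ Ioo (0:ℝ) 1) :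
    |evCopula A b y - evCopula B b y| ≤
      ∫ x in Icc (0:ℝ) 1, |evKernel A x y - evKernel B x y| := by
  refine le_of_forall_pos_le_add fun ε hε => ?_
  obtain ⟨a, ha0, hab, haε⟩ : ∃ a, 0 < a ∧ a ≤ b ∧ a ≤ ε :=
    ⟨min b ε, lt_min hb.1 hε, min_le_left _ _, min_le_right _ _⟩
  have ha : a ∈ Ioo (0:ℝ) 1 := ⟨ha0, hab.trans_lt hb.2⟩
  obtain ⟨hiA, hIA⟩ := integral_evKernel_left hA ha0 hab hb.2 hy
  obtain ⟨hiB, hIB⟩ := integral_evKernel_left hB ha0 hab hb.2 hy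
  have hI := intervalIntegral.integral_sub hiA hiB
  rw [hIA, hIB] at hI
  have h1 : |∫ x in a..b, (evKernel A x y - evKernel B x y)| ≤
      ∫ x in Icc (0:ℝ) 1, |evKernel A x y - evKernel B x y| := by
    refine (intervalIntegral.abs_integral_le_integral_abs hab).trans ?_
    rw [intervalIntegral.integral_of_le hab]
    refine setIntegral_mono_set ?_ (Eventually.of_forall fun _ => abs_nonneg _)
      (LE.le.eventuallyLE fun x hx => ⟨ha0.le.trans hx.1.le, hx.2.trans hb.2.le⟩)
    refine Integrable.of_bound ((measurable_abs_evKernel_sub hA hB).comp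
      measurable_prodMk_right).aestronglyMeasurable 1 (Eventually.of_forall fun x => ?_)
    simpa using abs_evKernel_sub_le hA hB x (Ioo_subset_Icc_self hy)
  have h2 : |evCopula A a y - evCopula B a y| ≤ a := by
    have hAp := evCopula_pos A ha hy
    have hBp := evCopula_pos B ha hy
    exact abs_sub_le_iff.2 ⟨by linarith [evCopula_le_left hA ha hy],
      by linarith [evCopula_le_left hB ha hy]⟩
  rw [hI] at h1
  rw [abs_le] at h1 h2 ⊢
  exact ⟨by linarith [h1.1, h2.1], by linarith [h1.2, h2.2]⟩

lemma exp_mul_sub_le_exp_sub_exp {c s t : ℝ} (hc : 0 ≤ c) (ht : t ≤ 1) (hst : s ≤ t) :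
    Real.exp (-c) * c * (t - s) ≤ Real.exp (-c * s) - Real.exp (-c * t) := by
  have h1 : Real.exp (-c) ≤ Real.exp (-c * t) := Real.exp_le_exp.2 (by nlinarith)
  have h2 : Real.exp (-c * s) = Real.exp (-c * t) * Real.exp (c * (t - s)) := by
    rw [← Real.exp_add]
    ring_nf
  have h3 := Real.add_one_le_exp (c * (t - s))
  have h4 : 0 ≤ c * (t - s) := mul_nonneg hc (sub_nonneg.2 hst)
  calc Real.exp (-c) * c * (t - s) = Real.exp (-c) * (c * (t - s)) := by ring
    _ ≤ Real.exp (-c * t) * (Real.exp (c * (t - s)) - 1) :=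
      mul_le_mul h1 (by linarith) h4 (Real.exp_pos _).le
    _ = _ := by rw [h2]; ring

lemma exp_mul_abs_sub_le_abs_exp_sub_exp {c s t : ℝ} (hc : 0 ≤ c) (hs : s ≤ 1) (ht : t ≤ 1) :
    Real.exp (-c) * c * |s - t| ≤ |Real.exp (-c * s) - Real.exp (-c * t)| := by
  rcases le_total s t with h | h
  · rw [abs_sub_comm s, abs_of_nonneg (sub_nonneg.2 h)]
    exact (exp_mul_sub_le_exp_sub_exp hc ht h).trans (le_abs_self _)
  · rw [abs_of_nonneg (sub_nonneg.2 h), abs_sub_comm]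
    exact (exp_mul_sub_le_exp_sub_exp hc hs h).trans (le_abs_self _)

/-- Every pair of a level `y` and an argument `z` is attained by a suitable first coordinate. -/
lemma exists_pickandsArg_eq {y z : ℝ} (hy : y ∈ Ioo (0:ℝ) 1) (hz : z ∈ Ioo (0:ℝ) 1) :
    ∃ b ∈ Ioo (0:ℝ) 1, pickandsArg b y = z ∧ Real.log (b * y) = Real.log y / (1 - z) := by
  have hly := Real.log_neg hy.1 hy.2
  have hz1 : 0 < 1 - z := sub_pos.2 hz.2
  have hb : Real.exp (Real.log y * (z / (1 - z))) ∈ Ioo (0:ℝ) 1 :=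
    ⟨Real.exp_pos _, Real.exp_lt_one_iff.2 (mul_neg_of_neg_of_pos hly (div_pos hz.1 hz1))⟩
  have hlog : Real.log (Real.exp (Real.log y * (z / (1 - z))) * y) = Real.log y / (1 - z) := by
    rw [log_mul_of_mem hb hy, Real.log_exp]
    field_simp
    ring
  refine ⟨_, hb, ?_, hlog⟩
  rw [pickandsArg, hlog, Real.log_exp]
  have := hly.ne
  field_simp

/-- The pointwise distance of two Pickands functions is controlled by the metric `D1`. -/
lemma exists_mul_abs_sub_le_D1 {z : ℝ} (hz : z ∈ Ioo (0:ℝ) 1) :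
    ∃ c > 0, ∀ A B : ℝ → ℝ, IsPickands A → IsPickands B →
      c * |A z - B z| ≤ D1 (evKernel A) (evKernel B) := by
  have hz1 : 0 < 1 - z := sub_pos.2 hz.2
  have hexp : ∀ y ∈ Icc (Real.exp (-2)) (Real.exp (-1)),
      y ∈ Ioo (0:ℝ) 1 ∧ -2 ≤ Real.log y ∧ Real.log y ≤ -1 := fun y hy => by
    have hy0 : 0 < y := (Real.exp_pos _).trans_le hy.1
    exact ⟨⟨hy0, hy.2.trans_lt (Real.exp_lt_one_iff.2 (by norm_num))⟩,
      (Real.le_log_iff_exp_le hy0).2 hy.1, (Real.log_le_iff_le_exp hy0).2 hy.2⟩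
  have hlt : Real.exp (-2) < Real.exp (-1) := Real.exp_lt_exp.2 (by norm_num)
  refine ⟨(Real.exp (-1) - Real.exp (-2)) * (Real.exp (-(2 / (1 - z))) * (1 / (1 - z))),
    mul_pos (sub_pos.2 hlt) (by positivity), fun A B hA hB => ?_⟩
  have hF : Integrable (fun y => ∫ x in Icc (0:ℝ) 1, |evKernel A x y - evKernel B x y|)
      (volume.restrict (Icc (0:ℝ) 1)) := (integrable_abs_evKernel_sub hA hB).integral_prod_right
  have hsub : Icc (Real.exp (-2)) (Real.exp (-1)) ⊆ Icc (0:ℝ) 1 := fun y hy =>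
    Ioo_subset_Icc_self (hexp y hy).1
  have hpt : ∀ y ∈ Icc (Real.exp (-2)) (Real.exp (-1)),
      Real.exp (-(2 / (1 - z))) * (1 / (1 - z)) * |A z - B z| ≤
        ∫ x in Icc (0:ℝ) 1, |evKernel A x y - evKernel B x y| := by
    intro y hy
    obtain ⟨hy01, hl2, hl1⟩ := hexp y hy
    obtain ⟨b, hb, hbz, hlog⟩ := exists_pickandsArg_eq hy01 hz
    refine le_trans ?_ (abs_evCopula_sub_le_integral hA hB hb hy01)
    rw [evCopula_of_mem A hb hy01, evCopula_of_mem B hb hy01, hbz, hlog]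
    have hc : 1 / (1 - z) ≤ -(Real.log y / (1 - z)) := by
      rw [← neg_div]
      gcongr
      linarith
    have hc2 : -(Real.log y / (1 - z)) ≤ 2 / (1 - z) := by
      rw [← neg_div]
      gcongr
      linarith
    have hc0 : 0 ≤ -(Real.log y / (1 - z)) := le_trans (by positivity) hc
    have hz' := Ioo_subset_Icc_self hz
    have key := exp_mul_abs_sub_le_abs_exp_sub_exp hc0 (hA.apply_le_one hz') (hB.apply_le_one hz')
    refine le_trans ?_ (key.trans_eq (by rw [neg_neg]))
    gcongr
  calc _ = ∫ _ in Icc (Real.exp (-2)) (Real.exp (-1)),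
        Real.exp (-(2 / (1 - z))) * (1 / (1 - z)) * |A z - B z| := by
        rw [setIntegral_const, Real.volume_real_Icc_of_le hlt.le, smul_eq_mul]
        ring
    _ ≤ ∫ y in Icc (Real.exp (-2)) (Real.exp (-1)),
        ∫ x in Icc (0:ℝ) 1, |evKernel A x y - evKernel B x y| :=
        setIntegral_mono_on (integrableOn_const (by simp)) (IntegrableOn.mono_set hF hsub)
          measurableSet_Icc hpt
    _ ≤ _ := setIntegral_mono_set hF
        (Eventually.of_forall fun y => integral_nonneg fun x => abs_nonneg _)
        (LE.le.eventuallyLE hsub)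

lemma tendsto_of_tendsto_D1 {A : ℝ → ℝ} {Aseq : ℕ → ℝ → ℝ}
    (hA : IsPickands A) (hAseq : ∀ n, IsPickands (Aseq n))
    (h : Tendsto (fun n => D1 (evKernel (Aseq n)) (evKernel A)) atTop (nhds 0)) :
    ∀ x ∈ Icc (0:ℝ) 1, Tendsto (fun n => Aseq n x) atTop (nhds (A x)) := by
  intro z hz
  rcases hz.1.eq_or_lt with rfl | h0
  · simp [hA.2.1, (hAseq _).2.1]
  rcases hz.2.eq_or_lt with rfl | h1
  · simp [hA.2.2.1, (hAseq _).2.2.1]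
  obtain ⟨c, hc, hle⟩ := exists_mul_abs_sub_le_D1 ⟨h0, h1⟩
  rw [tendsto_iff_dist_tendsto_zero]
  have h' := h.div_const c
  rw [zero_div] at h'
  refine squeeze_zero (fun _ => dist_nonneg) (fun n => ?_) h'
  rw [le_div_iff₀ hc, Real.dist_eq, mul_comm]
  exact hle _ _ (hAseq n) hA

/-- For Extreme Value copulas the following are equivalent:
(i) pointwise convergence of the Pickands dependence functions on `[0,1]`;
(ii) convergence of the copulas w.r.t. the metric `D₁`;
(iii) weak conditional convergence of the copulas. -/
theorem stmt16 (A : ℝ → ℝ) (Aseq : ℕ → ℝ → ℝ)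
    (hA : IsPickands A) (hAseq : ∀ n, IsPickands (Aseq n)) :
    ((∀ x ∈ Set.Icc (0:ℝ) 1,
        Filter.Tendsto (fun n => Aseq n x) Filter.atTop (nhds (A x)))
      ↔ Filter.Tendsto (fun n => D1 (evKernel (Aseq n)) (evKernel A))
          Filter.atTop (nhds 0)) ∧
    ((∀ x ∈ Set.Icc (0:ℝ) 1,
        Filter.Tendsto (fun n => Aseq n x) Filter.atTop (nhds (A x)))
      ↔ WeakCondConv (fun n => evKernel (Aseq n)) (evKernel A)) := by
  have h12 := weakCondConv_of_tendsto hA hAseq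
  have h23 := tendsto_D1_of_weakCondConv hA hAseq
  have h31 := tendsto_of_tendsto_D1 hA hAseq
  exact ⟨⟨fun h => h23 (h12 h), h31⟩, ⟨h12, fun h => h31 (h23 h)⟩⟩
end
end
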